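/- Let (X, d) be a compact metric space and T : X → X a continuous map with positive topological entropy h_top(T) > 0. Then there exist t₀ > 0, δ > 0 and an uncountable set E ⊆ X such that for every pair of distinct points x, y ∈ E: (i) for every t > 0, limsup_{n→∞} (1/n)·#{0 ≤ i ≤ n−1 : d(Tⁱx, Tⁱy) < t} = 1, and (ii) liminf_{n→∞} (1/n)·#{0 ≤ i ≤ n−1 : d(Tⁱx, Tⁱy) < t₀} ≤ 1 − δ. In other words, X contains an uncountable uniformly DC2-scrambled set, with the separation constant t₀ and the density gap δ common to all pairs. -/

import Mathlib

open Filter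

/-- The fraction of times `i ∈ [0, n-1]` with `dist (T^[i] x) (T^[i] y) < t`. -/
noncomputable def closeTimesFraction {X : Type*} [MetricSpace X] (T : X → X)
    (x y : X) (t : ℝ) (n : ℕ) : ℝ :=
  (((Finset.range n).filter (fun i => dist (T^[i] x) (T^[i] y) < t)).card : ℝ) / n


namespace DC2

/-- Finitely additive probability measures defined on all subsets. -/
structure FAM (X : Type*) where
  m : Set X → ℝ
  nonneg : ∀ s, 0 ≤ m s
  univ : m Set.univ = 1
  add : ∀ s t, Disjoint s t → m (s ∪ t) = m s + m t

namespace FAM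
variable {X : Type*} (μ : FAM X)

lemma empty : μ.m ∅ = 0 := by
  have := μ.add ∅ ∅ (by simp)
  simp at this
  exact this

lemma mono {s t : Set X} (h : s ⊆ t) : μ.m s ≤ μ.m t := by
  have := μ.add s (t \ s) Set.disjoint_sdiff_right
  rw [Set.union_sdiff_cancel h] at this
  have := μ.nonneg (t \ s)
  linarith

lemma le_one (s : Set X) : μ.m s ≤ 1 := by
  rw [← μ.univ]; exact μ.mono (Set.subset_univ s)

lemma biUnion {ι : Type*} (I : Finset ι) (s : ι → Set X)
    (hd : ∀ i ∈ I, ∀ j ∈ I, i ≠ j → Disjoint (s i) (s j)) :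
    μ.m (⋃ i ∈ I, s i) = ∑ i ∈ I, μ.m (s i) := by
  classical
  induction I using Finset.induction_on with
  | empty => simp [μ.empty]
  | insert a I ha ih =>
    rw [Finset.set_biUnion_insert, Finset.sum_insert ha, μ.add, ih]
    · intro i hi j hj
      exact hd i (Finset.mem_insert_of_mem hi) j (Finset.mem_insert_of_mem hj)
    · rw [Set.disjoint_iUnion₂_right]
      intro i hi
      exact hd a (Finset.mem_insert_self _ _) i (Finset.mem_insert_of_mem hi)
        (by rintro rfl; exact ha hi)

lemma iUnion_fiber {α : Type*} [Fintype α] (f : X → α) (s : Set X) :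
    ∑ a, μ.m (s ∩ f ⁻¹' {a}) = μ.m s := by
  rw [← μ.biUnion]
  · congr 1
    ext x; simp
  · intro i _ j _ hij
    rw [Set.disjoint_left]
    rintro x ⟨_, h1⟩ ⟨_, h2⟩
    simp at h1 h2
    exact hij (h1.symm.trans h2)

lemma sum_fiber {α : Type*} [Fintype α] (f : X → α) : ∑ a, μ.m (f ⁻¹' {a}) = 1 := by
  have := μ.iUnion_fiber f Set.univ
  simpa [μ.univ] using this

lemma marg_left {α β : Type*} [Fintype β] (f : X → α) (g : X → β) (a : α) :
    ∑ b, μ.m ((fun x => (f x, g x)) ⁻¹' {(a, b)}) = μ.m (f ⁻¹' {a}) := by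
  rw [← μ.iUnion_fiber g]
  refine Finset.sum_congr rfl fun b _ => ?_
  congr 1; ext x; simp

lemma marg_right {α β : Type*} [Fintype α] (f : X → α) (g : X → β) (b : β) :
    ∑ a, μ.m ((fun x => (f x, g x)) ⁻¹' {(a, b)}) = μ.m (g ⁻¹' {b}) := by
  rw [← μ.iUnion_fiber f]
  refine Finset.sum_congr rfl fun b _ => ?_
  congr 1; ext x; simp [and_comm]

/-- Shannon entropy of a finite valued function. -/
noncomputable def H {α : Type*} [Fintype α] (f : X → α) : ℝ :=
  ∑ a, Real.negMulLog (μ.m (f ⁻¹' {a}))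

lemma nonempty_of_ne {s : Set X} (h : μ.m s ≠ 0) : s.Nonempty := by
  by_contra hs
  rw [Set.not_nonempty_iff_eq_empty] at hs
  exact h (by rw [hs, μ.empty])

/-- Conditional Gibbs inequality. -/
lemma gibbs {α β : Type*} [Fintype α] [Fintype β] (f : X → α) (g : X → β) (q : α → β → ℝ)
    (hq0 : ∀ a b, 0 ≤ q a b) (hq1 : ∀ b, ∑ a, q a b ≤ 1)
    (hq : ∀ a b, μ.m ((fun x => (f x, g x)) ⁻¹' {(a, b)}) ≠ 0 → 0 < q a b) :
    μ.H (fun x => (f x, g x)) - μ.H g ≤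
      ∑ a, ∑ b, μ.m ((fun x => (f x, g x)) ⁻¹' {(a, b)}) * (- Real.log (q a b)) := by
  set p : α → β → ℝ := fun a b => μ.m ((fun x => (f x, g x)) ⁻¹' {(a, b)}) with hp
  set r : β → ℝ := fun b => μ.m (g ⁻¹' {b}) with hr
  have hpr : ∀ b, ∑ a, p a b = r b := fun b => μ.marg_right f g b
  have hp0 : ∀ a b, 0 ≤ p a b := fun a b => μ.nonneg _
  have hr0 : ∀ b, 0 ≤ r b := fun b => μ.nonneg _
  have e1 : μ.H (fun x => (f x, g x)) = ∑ a, ∑ b, Real.negMulLog (p a b) := by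
    rw [H, Fintype.sum_prod_type]
  have e2 : μ.H g = ∑ a, ∑ b, p a b * (- Real.log (r b)) := by
    rw [H, Finset.sum_comm]
    refine Finset.sum_congr rfl fun b _ => ?_
    rw [← Finset.sum_mul, hpr, Real.negMulLog]; ring
  have key : ∀ a b, Real.negMulLog (p a b) - p a b * (- Real.log (r b))
      - p a b * (- Real.log (q a b)) ≤ r b * q a b - p a b := by
    intro a b
    by_cases h : p a b = 0
    · rw [h]; simp; exact mul_nonneg (hr0 b) (hq0 a b)
    · have hpp : 0 < p a b := lt_of_le_of_ne (hp0 a b) (Ne.symm h)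
      have hrp : 0 < r b := by
        rw [← hpr b]
        exact lt_of_lt_of_le hpp (Finset.single_le_sum (f := fun a => p a b)
          (fun i _ => hp0 i b) (Finset.mem_univ a))
      have hqp := hq a b h
      have := Real.log_le_sub_one_of_pos (x := r b * q a b / p a b) (by positivity)
      rw [Real.log_div (by positivity) h, Real.log_mul hrp.ne' hqp.ne'] at this
      have h3 := mul_le_mul_of_nonneg_left this hpp.le
      have h4 : p a b * (r b * q a b / p a b - 1) = r b * q a b - p a b := by
        field_simp
      rw [h4] at h3
      rw [Real.negMulLog]
      linarith
  have hs : ∑ a, ∑ b, (r b * q a b - p a b) ≤ 0 := by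
    rw [Finset.sum_comm]
    apply Finset.sum_nonpos
    intro b _
    rw [Finset.sum_sub_distrib, ← Finset.mul_sum, hpr]
    nlinarith [hr0 b, hq1 b]
  have := Finset.sum_le_sum fun a (_ : a ∈ Finset.univ) =>
    Finset.sum_le_sum fun b (_ : b ∈ Finset.univ) => key a b
  simp only [Finset.sum_sub_distrib] at this hs
  rw [e1, e2]
  linarith

lemma H_le_pair {α β : Type*} [Fintype α] [Fintype β] (f : X → α) (g : X → β) :
    μ.H f ≤ μ.H (fun x => (f x, g x)) := by
  rw [H, H, Fintype.sum_prod_type]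
  refine Finset.sum_le_sum fun a _ => ?_
  rw [← μ.marg_left f g a, Real.negMulLog, ← Finset.sum_neg_distrib, Finset.sum_mul]
  refine Finset.sum_le_sum fun b _ => ?_
  rw [Real.negMulLog, neg_mul, neg_mul, neg_le_neg_iff]
  rcases (μ.nonneg ((fun x => (f x, g x)) ⁻¹' {(a, b)})).eq_or_lt with h | h
  · rw [← h]; simp
  · apply mul_le_mul_of_nonneg_left _ h.le
    apply Real.log_le_log h
    exact Finset.single_le_sum (f := fun b => μ.m ((fun x => (f x, g x)) ⁻¹' {(a, b)}))
      (fun i _ => μ.nonneg _) (Finset.mem_univ b)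

lemma H_pair_le {α β : Type*} [Fintype α] [Fintype β] (f : X → α) (g : X → β)
    (h : ∀ x y, g x = g y → f x = f y) : μ.H (fun x => (f x, g x)) ≤ μ.H g := by
  classical
  have := μ.gibbs f g (fun a b => if ∃ x, f x = a ∧ g x = b then 1 else 0)
    (fun a b => by split_ifs <;> norm_num)
    (fun b => by
      rw [Finset.sum_ite]
      simp only [Finset.sum_const_zero, add_zero, Finset.sum_const, nsmul_eq_mul, mul_one]
      norm_cast
      rw [Finset.card_le_one]
      simp only [Finset.mem_filter, Finset.mem_univ, true_and]
      rintro a ⟨x, rfl, hx⟩ a' ⟨y, rfl, hy⟩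
      exact h x y (hx.trans hy.symm))
    (fun a b hab => by
      obtain ⟨x, hx⟩ := μ.nonempty_of_ne hab
      simp at hx
      rw [if_pos ⟨x, hx⟩]; norm_num)
  have h0 : ∀ a b, Real.log (if ∃ x, f x = a ∧ g x = b then (1:ℝ) else 0) = 0 := by
    intro a b; split_ifs <;> simp
  simp only [h0, neg_zero, mul_zero, Finset.sum_const_zero] at this
  linarith

lemma H_pair_swap_le {α β : Type*} [Fintype α] [Fintype β] (f : X → α) (g : X → β) :
    μ.H (fun x => (f x, g x)) ≤ μ.H (fun x => (g x, f x)) := by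
  rw [H, H, Fintype.sum_prod_type, Fintype.sum_prod_type, Finset.sum_comm]
  apply le_of_eq
  refine Finset.sum_congr rfl fun a _ => Finset.sum_congr rfl fun b _ => ?_
  congr 2; ext x; simp [and_comm]

lemma H_mono {α β : Type*} [Fintype α] [Fintype β] (f : X → α) (g : X → β)
    (h : ∀ x y, g x = g y → f x = f y) : μ.H f ≤ μ.H g :=
  (μ.H_le_pair f g).trans (μ.H_pair_le f g h)

lemma H_congr {α β : Type*} [Fintype α] [Fintype β] (f : X → α) (g : X → β)
    (h : ∀ x y, g x = g y ↔ f x = f y) : μ.H f = μ.H g :=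
  le_antisymm (μ.H_mono f g fun x y => (h x y).1) (μ.H_mono g f fun x y => (h x y).2)

lemma submod {α β γ : Type*} [Fintype α] [Fintype β] [Fintype γ]
    (f : X → α) (g : X → β) (k : X → γ) :
    μ.H (fun x => (f x, (g x, k x))) + μ.H k ≤
      μ.H (fun x => (f x, k x)) + μ.H (fun x => (g x, k x)) := by
  have G := μ.gibbs f (fun x => (g x, k x))
    (fun a bc => μ.m ((fun x => (f x, k x)) ⁻¹' {(a, bc.2)}) / μ.m (k ⁻¹' {bc.2}))
    (fun a b => div_nonneg (μ.nonneg _) (μ.nonneg _))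
    (fun b => by
      rw [← Finset.sum_div, μ.marg_right]
      exact div_self_le_one _)
    (fun a b h => by
      have h1 : 0 < μ.m ((fun x => (f x, (g x, k x))) ⁻¹' {(a, b)}) :=
        lt_of_le_of_ne (μ.nonneg _) (Ne.symm h)
      apply div_pos
      · refine lt_of_lt_of_le h1 (μ.mono ?_)
        intro x; simp; rintro rfl rfl; simp
      · refine lt_of_lt_of_le h1 (μ.mono ?_)
        intro x; simp; rintro rfl rfl; simp)
  have e : ∑ a, ∑ b : β × γ, μ.m ((fun x => (f x, (g x, k x))) ⁻¹' {(a, b)}) *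
      (- Real.log (μ.m ((fun x => (f x, k x)) ⁻¹' {(a, b.2)}) / μ.m (k ⁻¹' {b.2})))
      = μ.H (fun x => (f x, k x)) - μ.H k := by
    have e0 : ∀ a c, ∑ b, μ.m ((fun x => (f x, (g x, k x))) ⁻¹' {(a, (b, c))})
        = μ.m ((fun x => (f x, k x)) ⁻¹' {(a, c)}) := by
      intro a c
      rw [← μ.iUnion_fiber g]
      refine Finset.sum_congr rfl fun b _ => ?_
      congr 1; ext x; simp; tauto
    have e1 : ∀ a, ∑ b : β × γ, μ.m ((fun x => (f x, (g x, k x))) ⁻¹' {(a, b)}) *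
      (- Real.log (μ.m ((fun x => (f x, k x)) ⁻¹' {(a, b.2)}) / μ.m (k ⁻¹' {b.2})))
      = ∑ c, (Real.negMulLog (μ.m ((fun x => (f x, k x)) ⁻¹' {(a, c)})) +
        μ.m ((fun x => (f x, k x)) ⁻¹' {(a, c)}) * Real.log (μ.m (k ⁻¹' {c}))) := by
      intro a
      rw [Fintype.sum_prod_type, Finset.sum_comm]
      refine Finset.sum_congr rfl fun c _ => ?_
      dsimp only
      rw [← Finset.sum_mul, e0]
      by_cases h : μ.m ((fun x => (f x, k x)) ⁻¹' {(a, c)}) = 0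
      · rw [h]; simp
      · have h1 : 0 < μ.m ((fun x => (f x, k x)) ⁻¹' {(a, c)}) :=
          lt_of_le_of_ne (μ.nonneg _) (Ne.symm h)
        have h2 : 0 < μ.m (k ⁻¹' {c}) := by
          refine lt_of_lt_of_le h1 (μ.mono ?_)
          intro x; simp
        rw [Real.log_div h h2.ne', Real.negMulLog]; ring
    simp only [e1, Finset.sum_add_distrib]
    rw [H, H, Fintype.sum_prod_type]
    have e2 : ∑ a, ∑ c, μ.m ((fun x => (f x, k x)) ⁻¹' {(a, c)}) * Real.log (μ.m (k ⁻¹' {c}))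
        = ∑ c, μ.m (k ⁻¹' {c}) * Real.log (μ.m (k ⁻¹' {c})) := by
      rw [Finset.sum_comm]
      simp only [← Finset.sum_mul, μ.marg_right]
    rw [e2]
    simp only [← Finset.sum_mul, μ.marg_right, Real.negMulLog, neg_mul, Finset.sum_neg_distrib]
    ring
  rw [e] at G
  linarith

lemma H_le_log_card {α : Type*} [Fintype α] [Nonempty α] (f : X → α) :
    μ.H f ≤ Real.log (Fintype.card α) := by
  have G := μ.gibbs f (fun _ => ()) (fun _ _ => (Fintype.card α : ℝ)⁻¹)
    (fun _ _ => by positivity) (fun _ => by simp) (fun _ _ _ => by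
      have := Fintype.card_pos (α := α); positivity)
  have h1 : μ.H (fun _ : X => ()) = 0 := by
    simp [H, μ.univ]
  have h2 : μ.H f ≤ μ.H (fun x => (f x, ())) := μ.H_le_pair f _
  simp only [Real.log_inv, neg_neg, ← Finset.sum_mul, Finset.univ_unique, Finset.sum_singleton] at G
  have h3 : ∑ a, μ.m ((fun x => (f x, ())) ⁻¹' {(a, default)}) = 1 := by
    rw [← μ.sum_fiber f]
    refine Finset.sum_congr rfl fun a _ => ?_
    congr 1; ext x; simp
  rw [h3] at G
  linarith

end FAM
end DC2


namespace DC2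

/-- The window `[a, b)` at level `k`. -/
def W (k a b : ℕ) : Finset (ℕ × ℕ) := (Finset.Ico a b) ×ˢ {k}

lemma mem_W {k a b t l : ℕ} : (t, l) ∈ W k a b ↔ (a ≤ t ∧ t < b) ∧ l = k := by
  simp only [W, Finset.mem_product, Finset.mem_Ico, Finset.mem_singleton]

/-- Domination: every coordinate of `A` is determined by a coordinate of `B`. -/
def Dom (A B : Finset (ℕ × ℕ)) : Prop := ∀ t l, (t, l) ∈ A → ∃ l', (t, l') ∈ B ∧ l ≤ l'

/-- Shift invariant polymatroids. -/
structure Poly (H : Finset (ℕ × ℕ) → ℝ) : Prop where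
  h0 : H ∅ = 0
  mono : ∀ A B, Dom A B → H A ≤ H B
  sub : ∀ A B, H (A ∪ B) + H (A ∩ B) ≤ H A + H B
  shift : ∀ A, H (A.image fun p => (p.1 + 1, p.2)) = H A

lemma Dom.of_subset {A B : Finset (ℕ × ℕ)} (h : A ⊆ B) : Dom A B :=
  fun _ l hl => ⟨l, h hl, le_rfl⟩

lemma Dom.union {A B C : Finset (ℕ × ℕ)} (h : Dom A C) (h' : Dom B C) : Dom (A ∪ B) C := by
  intro t l hl
  rcases Finset.mem_union.1 hl with hl | hl
  · exact h t l hl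
  · exact h' t l hl

lemma Dom.left {A B C : Finset (ℕ × ℕ)} (h : Dom A B) : Dom A (B ∪ C) := by
  intro t l hl
  obtain ⟨l', h1, h2⟩ := h t l hl
  exact ⟨l', Finset.mem_union_left _ h1, h2⟩

lemma Dom.right {A B C : Finset (ℕ × ℕ)} (h : Dom A C) : Dom A (B ∪ C) := by
  intro t l hl
  obtain ⟨l', h1, h2⟩ := h t l hl
  exact ⟨l', Finset.mem_union_right _ h1, h2⟩

lemma Dom.refl (A : Finset (ℕ × ℕ)) : Dom A A := Dom.of_subset (Finset.Subset.refl _)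

lemma dom_W {k k' a b a' b' : ℕ} (hk : k ≤ k') (ha : a' ≤ a) (hb : b ≤ b') :
    Dom (W k a b) (W k' a' b') := by
  intro t l h
  rw [mem_W] at h
  exact ⟨k', by rw [mem_W]; omega, by omega⟩

lemma dom_W2 {k l k' a b a' m b' : ℕ} (hk : k ≤ l) (hk' : k ≤ k') (ha : a' ≤ a) (hb : b ≤ b') :
    Dom (W k a b) (W l a' m ∪ W k' m b') := by
  intro t x h
  rw [mem_W] at h
  by_cases htm : t < m
  · exact ⟨l, by rw [Finset.mem_union, mem_W]; left; omega, by omega⟩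
  · exact ⟨k', by rw [Finset.mem_union, mem_W, mem_W]; right; omega, by omega⟩

namespace Poly
variable {H : Finset (ℕ × ℕ) → ℝ}

lemma nonneg
    (P : Poly H)
    (A) : 0 ≤ H A := by
  rw [← P.h0]; exact P.mono _ _ (Dom.of_subset (Finset.empty_subset _))

lemma eq
    (P : Poly H)
    {A B} (h : Dom A B) (h' : Dom B A) : H A = H B :=
  le_antisymm (P.mono _ _ h) (P.mono _ _ h')

lemma sub3
    (P : Poly H)
    (A B C : Finset (ℕ × ℕ)) : H (A ∪ B ∪ C) + H C ≤ H (A ∪ C) + H (B ∪ C) := by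
  have h1 := P.sub (A ∪ C) (B ∪ C)
  have h2 : H C ≤ H ((A ∪ C) ∩ (B ∪ C)) := P.mono _ _ (Dom.of_subset (by
    intro x hx; simp [hx]))
  have h3 : A ∪ C ∪ (B ∪ C) = A ∪ B ∪ C := by ext x; simp; tauto
  rw [h3] at h1
  linarith

lemma sub2
    (P : Poly H)
    (A B : Finset (ℕ × ℕ)) : H (A ∪ B) ≤ H A + H B := by
  have := P.sub A B
  have := P.nonneg (A ∩ B)
  linarith

/-- conditioning decreases entropy -/
lemma cond
    (P : Poly H)
    {A B B' : Finset (ℕ × ℕ)} (h : Dom B B') :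
    H (A ∪ B') - H B' ≤ H (A ∪ B) - H B := by
  have h1 := P.sub3 A B' B
  have h2 : H (B' ∪ B) = H B' := P.eq ((Dom.refl _).union h) (Dom.refl _).left
  have h3 : H (A ∪ B') ≤ H (A ∪ B' ∪ B) := P.mono _ _ (Dom.refl _).left
  linarith

lemma shiftn
    (P : Poly H)
    (s : ℕ) (A : Finset (ℕ × ℕ)) : H (A.image fun p => (p.1 + s, p.2)) = H A := by
  induction s with
  | zero => simp
  | succ s ih =>
    rw [← ih, ← P.shift (A.image fun p => (p.1 + s, p.2)), Finset.image_image]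
    rfl

lemma W_image
    (k a b s : ℕ) :
    (W k a b).image (fun p => (p.1 + s, p.2)) = W k (a + s) (b + s) := by
  ext ⟨t, l⟩
  simp only [Finset.mem_image, Prod.exists, mem_W, Prod.mk.injEq]
  constructor
  · rintro ⟨t', l', h, rfl, rfl⟩; omega
  · intro h; exact ⟨t - s, l, by omega, by omega, rfl⟩

lemma shiftW
    (P : Poly H)
    (k a b s : ℕ) : H (W k (a + s) (b + s)) = H (W k a b) := by
  rw [← W_image, P.shiftn]

lemma shiftW2
    (P : Poly H)
    (k a b k' a' b' s : ℕ) :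
    H (W k (a + s) (b + s) ∪ W k' (a' + s) (b' + s)) = H (W k a b ∪ W k' a' b') := by
  rw [← W_image, ← W_image, ← Finset.image_union, P.shiftn]

lemma W0
    (P : Poly H)
    (k a : ℕ) : H (W k a a) = 0 := by
  simp [W, P.h0]

lemma incr_anti
    (P : Poly H)
    (k : ℕ) : Antitone fun n => H (W k 0 (n + 1)) - H (W k 0 n) := by
  have e : ∀ n, H (W k 0 (n + 1)) - H (W k 0 n) =
      H (W k 0 1 ∪ W k 1 (n + 1)) - H (W k 1 (n + 1)) := by
    intro n
    have h1 := P.shiftW k 0 n 1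
    rw [zero_add] at h1
    rw [h1]
    congr 1
    exact P.eq (dom_W2 le_rfl le_rfl le_rfl le_rfl)
      ((dom_W le_rfl le_rfl (by omega)).union (dom_W le_rfl (by omega) le_rfl))
  apply antitone_nat_of_succ_le
  intro n
  rw [e, e]
  exact P.cond (dom_W le_rfl le_rfl (by omega))

lemma exists_h
    (P : Poly H)
    : ∃ h : ℕ → ℝ, ∀ k, Tendsto (fun n => H (W k 0 (n + 1)) - H (W k 0 n)) atTop
    (nhds (h k)) := by
  have : ∀ k, ∃ h, Tendsto (fun n => H (W k 0 (n + 1)) - H (W k 0 n)) atTop (nhds h) := by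
    intro k
    refine ⟨_, tendsto_atTop_ciInf (P.incr_anti k) ⟨0, ?_⟩⟩
    rintro _ ⟨n, rfl⟩
    have := P.mono (W k 0 n) (W k 0 (n + 1)) (dom_W le_rfl le_rfl (by omega))
    simp only
    linarith
  choose h hh using this
  exact ⟨h, hh⟩

variable {h : ℕ → ℝ}

lemma h_le
    (P : Poly H)
    (hh : ∀ k, Tendsto (fun n => H (W k 0 (n + 1)) - H (W k 0 n)) atTop (nhds (h k)))
    (k n : ℕ) : h k ≤ H (W k 0 (n + 1)) - H (W k 0 n) :=
  (P.incr_anti k).le_of_tendsto (hh k) n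

lemma block_ge
    (P : Poly H)
    (hh : ∀ k, Tendsto (fun n => H (W k 0 (n + 1)) - H (W k 0 n)) atTop (nhds (h k)))
    (k a n : ℕ) : a * h k ≤ H (W k 0 (n + a)) - H (W k 0 n) := by
  induction a with
  | zero => simp
  | succ a ih =>
    have := P.h_le hh k (n + a)
    push_cast
    rw [← add_assoc]
    linarith

lemma block_ge'
    (P : Poly H)
    (hh : ∀ k, Tendsto (fun n => H (W k 0 (n + 1)) - H (W k 0 n)) atTop (nhds (h k)))
    (k a : ℕ) : a * h k ≤ H (W k 0 a) := by
  have := P.block_ge hh k a 0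
  rw [P.W0] at this
  simpa using this

lemma block_le
    (P : Poly H)
    (k a n : ℕ) :
    H (W k 0 (n + a)) - H (W k 0 n) ≤ a * (H (W k 0 (n + 1)) - H (W k 0 n)) := by
  induction a with
  | zero => simp
  | succ a ih =>
    have := P.incr_anti k (show n ≤ n + a by omega)
    simp only at this
    push_cast
    rw [← add_assoc]
    linarith

lemma rate
    (P : Poly H)
    (hh : ∀ k, Tendsto (fun n => H (W k 0 (n + 1)) - H (W k 0 n)) atTop (nhds (h k)))
    (k : ℕ) : Tendsto (fun n : ℕ => H (W k 0 n) / n) atTop (nhds (h k)) := by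
  have := (hh k).cesaro
  refine this.congr fun n => ?_
  rw [Finset.sum_range_sub (fun n => H (W k 0 n)), P.W0]
  ring

lemma base
    (P : Poly H)
    (hh : ∀ k, Tendsto (fun n => H (W k 0 (n + 1)) - H (W k 0 n)) atTop (nhds (h k)))
    {k k' a b : ℕ} (hk : k ≤ k') (hab : a ≤ b) :
    H (W k 0 a) - (H (W k' 0 a) - a * h k') ≤
      H (W k 0 a ∪ W k' a b) - H (W k' a b) := by
  have h1 := P.sub3 (W k' a b) (W k' 0 a) (W k 0 a)
  have h2 : H (W k' 0 a ∪ W k 0 a) = H (W k' 0 a) :=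
    P.eq ((Dom.refl _).union (dom_W hk le_rfl le_rfl)) (Dom.refl _).left
  have h3 : H (W k' 0 b) ≤ H (W k' a b ∪ W k' 0 a ∪ W k 0 a) := by
    apply P.mono
    apply Dom.left
    rw [Finset.union_comm]
    exact dom_W2 le_rfl le_rfl le_rfl le_rfl
  have h4 : H (W k' a b) = H (W k' 0 (b - a)) := by
    have := P.shiftW k' 0 (b - a) a
    rwa [zero_add, Nat.sub_add_cancel hab] at this
  have h5 := P.block_ge hh k' a (b - a)
  rw [Nat.sub_add_cancel hab] at h5
  rw [Finset.union_comm (W k 0 a)]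
  linarith

lemma step_le
    (P : Poly H)
    {k k' : ℕ} (n c i : ℕ) (j b : ℕ) (hij : i < j)
    (hd : Dom (W k (i+1) (n+i) ∪ W k' (n+i) (c+i)) (W k (i+1) j ∪ W k' j b)) (hn : 0 < n) :
    H (W k i j ∪ W k' j b) - H (W k (i+1) j ∪ W k' j b) ≤
      H (W k 0 n ∪ W k' n c) - H (W k 1 n ∪ W k' n c) := by
  have h1 := P.shiftW2 k 0 n k' n c i
  have h2 := P.shiftW2 k 1 n k' n c i
  rw [← h1, ← h2]
  have h3 := P.cond (A := W k i (i+1)) hd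
  have h4 : H (W k i j ∪ W k' j b) = H (W k i (i+1) ∪ (W k (i+1) j ∪ W k' j b)) := by
    rw [← Finset.union_assoc]
    apply P.eq
    · exact (dom_W2 le_rfl le_rfl le_rfl le_rfl).left.union (Dom.refl _).right
    · exact ((dom_W le_rfl le_rfl (by omega)).union (dom_W le_rfl (by omega) le_rfl)).left.union
        (Dom.refl _).right
  have h5 : H (W k (0+i) (n+i) ∪ W k' (n+i) (c+i)) =
      H (W k i (i+1) ∪ (W k (i+1) (n+i) ∪ W k' (n+i) (c+i))) := by
    rw [← Finset.union_assoc, zero_add]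
    apply P.eq
    · exact (dom_W2 le_rfl le_rfl le_rfl le_rfl).left.union (Dom.refl _).right
    · exact ((dom_W le_rfl le_rfl (by omega)).union (dom_W le_rfl (by omega) le_rfl)).left.union
        (Dom.refl _).right
  rw [h4, h5, add_comm 1 i]
  exact h3

lemma lemB
    (P : Poly H)
    (hh : ∀ k, Tendsto (fun n => H (W k 0 (n + 1)) - H (W k 0 n)) atTop (nhds (h k)))
    {k k' : ℕ} (hk : k ≤ k') (n c : ℕ) (hn : 0 < n) (hnc : n ≤ c) :
    n * h k - (H (W k' 0 n) - n * h k') ≤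
      n * (H (W k 0 n ∪ W k' n c) - H (W k 1 n ∪ W k' n c)) := by
  have h1 := P.base hh hk (show n ≤ c + n by omega)
  have h2 := P.block_ge' hh k n
  have h3 := Finset.sum_range_sub' (fun i => H (W k i n ∪ W k' n (c + n))) n
  have h4 : H (W k n n ∪ W k' n (c+n)) = H (W k' n (c+n)) := by simp [W]
  have h5 : ∑ i ∈ Finset.range n,
      (H (W k i n ∪ W k' n (c + n)) - H (W k (i+1) n ∪ W k' n (c + n))) ≤
      ∑ i ∈ Finset.range n, (H (W k 0 n ∪ W k' n c) - H (W k 1 n ∪ W k' n c)) := by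
    apply Finset.sum_le_sum
    intro i hi
    rw [Finset.mem_range] at hi
    apply P.step_le n c i n (c+n) hi _ hn
    exact (dom_W2 le_rfl hk le_rfl (by omega)).union (dom_W le_rfl (by omega) (by omega)).right
  rw [h3, h4] at h5
  simp only [Finset.sum_const, Finset.card_range, nsmul_eq_mul] at h5
  linarith

lemma lemC_aux
    (P : Poly H)
    {k k' : ℕ} (hk : k ≤ k') (n a j b c : ℕ) (hn : 0 < n) (hj : a + n ≤ j)
    (hc : b ≤ c) (hjc : j ≤ c) :
    a * (H (W k 0 n ∪ W k' n c) - H (W k 1 n ∪ W k' n c)) ≤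
    H (W k 0 a ∪ (W k a j ∪ W k' j b)) - H (W k a j ∪ W k' j b) := by
  have e1 : H (W k 0 a ∪ (W k a j ∪ W k' j b)) = H (W k 0 j ∪ W k' j b) := by
    rw [← Finset.union_assoc]
    apply P.eq
    · exact ((dom_W le_rfl le_rfl (by omega)).union (dom_W le_rfl (by omega) le_rfl)).left.union
        (Dom.refl _).right
    · exact (dom_W2 le_rfl le_rfl le_rfl le_rfl).left.union (Dom.refl _).right
  rw [e1]
  have h3 := Finset.sum_range_sub' (fun i => H (W k i j ∪ W k' j b)) a
  rw [← h3]
  have e2 : (a : ℝ) * (H (W k 0 n ∪ W k' n c) - H (W k 1 n ∪ W k' n c)) =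
      ∑ i ∈ Finset.range a, (H (W k 0 n ∪ W k' n c) - H (W k 1 n ∪ W k' n c)) := by
    simp only [Finset.sum_const, Finset.card_range, nsmul_eq_mul]
  rw [e2]
  apply Finset.sum_le_sum
  intro i hi
  rw [Finset.mem_range] at hi
  have h1 := P.shiftW2 k 0 n k' n c i
  have h2 := P.shiftW2 k 1 n k' n c i
  rw [← h1, ← h2]
  have hd : Dom (W k (i+1) j ∪ W k' j b) (W k (i+1) (n+i) ∪ W k' (n+i) (c+i)) :=
    (dom_W2 le_rfl hk le_rfl (by omega)).union (dom_W le_rfl (by omega) (by omega)).right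
  have h3 := P.cond (A := W k i (i+1)) hd
  have h4 : H (W k i j ∪ W k' j b) = H (W k i (i+1) ∪ (W k (i+1) j ∪ W k' j b)) := by
    rw [← Finset.union_assoc]
    apply P.eq
    · exact (dom_W2 le_rfl le_rfl le_rfl le_rfl).left.union (Dom.refl _).right
    · exact ((dom_W le_rfl le_rfl (by omega)).union (dom_W le_rfl (by omega) le_rfl)).left.union
        (Dom.refl _).right
  have h5 : H (W k (0+i) (n+i) ∪ W k' (n+i) (c+i)) =
      H (W k i (i+1) ∪ (W k (i+1) (n+i) ∪ W k' (n+i) (c+i))) := by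
    rw [← Finset.union_assoc, zero_add]
    apply P.eq
    · exact (dom_W2 le_rfl le_rfl le_rfl le_rfl).left.union (Dom.refl _).right
    · exact ((dom_W le_rfl le_rfl (by omega)).union (dom_W le_rfl (by omega) le_rfl)).left.union
        (Dom.refl _).right
  rw [h4, h5, add_comm 1 i]
  exact h3

lemma lemC
    (P : Poly H)
    (hh : ∀ k, Tendsto (fun n => H (W k 0 (n + 1)) - H (W k 0 n)) atTop (nhds (h k)))
    {k k' : ℕ} (hk : k ≤ k') (n a j b : ℕ) (hn : 0 < n) (hj : a + n ≤ j) :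
    a * (h k - (H (W k' 0 n) / n - h k')) ≤
    H (W k 0 a ∪ (W k a j ∪ W k' j b)) - H (W k a j ∪ W k' j b) := by
  refine le_trans ?_ (P.lemC_aux hk n a j b (b + j + n) hn hj (by omega) (by omega))
  apply mul_le_mul_of_nonneg_left _ (Nat.cast_nonneg a)
  have h1 := P.lemB hh hk n (b + j + n) hn (by omega)
  have hn' : (0:ℝ) < n := by exact_mod_cast hn
  rw [← mul_le_mul_iff_right₀ hn']
  refine le_trans (le_of_eq ?_) h1
  field_simp

lemma lemD
    (P : Poly H)
    (hh : ∀ k, Tendsto (fun n => H (W k 0 (n + 1)) - H (W k 0 n)) atTop (nhds (h k)))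
    {k k' : ℕ} (hk : k ≤ k') (a : ℕ) {η : ℝ} (hη : 0 < η) :
    ∀ᶠ j in atTop, ∀ b, (H (W k 0 a ∪ W k a j) - H (W k a j)) -
      (H (W k 0 a ∪ (W k a j ∪ W k' j b)) - H (W k a j ∪ W k' j b)) ≤ η := by
  have ha : (0:ℝ) < a + 1 := by positivity
  set e : ℝ := η / (2 * (a + 1)) with he
  have he0 : 0 < e := by positivity
  have hae : a * e ≤ η / 2 := by
    rw [he, mul_div_assoc', div_le_iff₀ (by positivity)]
    nlinarith
  have h1 : ∀ᶠ n : ℕ in atTop, H (W k' 0 n) / n < h k' + e :=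
    (P.rate hh k').eventually_lt_const (by linarith)
  have h2 : ∀ᶠ n : ℕ in atTop, H (W k 0 (n + 1)) - H (W k 0 n) < h k + e :=
    (hh k).eventually_lt_const (by linarith)
  obtain ⟨n, hn, hn0⟩ := (h1.and (eventually_gt_atTop 0)).exists
  obtain ⟨N, hN⟩ := eventually_atTop.1 h2
  filter_upwards [eventually_ge_atTop (a + n + N)] with j hj b
  have h3 := P.lemC hh hk n a j b hn0 (by omega)
  have h4 := P.block_le k a (j - a)
  rw [Nat.sub_add_cancel (by omega)] at h4
  have h5 := hN (j - a) (by omega)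
  have h6 : H (W k 0 a ∪ W k a j) = H (W k 0 j) :=
    P.eq ((dom_W le_rfl le_rfl (by omega)).union (dom_W le_rfl (by omega) le_rfl))
      (dom_W2 le_rfl le_rfl le_rfl le_rfl)
  have h7 : H (W k a j) = H (W k 0 (j - a)) := by
    have := P.shiftW k 0 (j - a) a
    rwa [zero_add, Nat.sub_add_cancel (by omega)] at this
  rw [h6, h7]
  have h8 : (a : ℝ) * (H (W k 0 (j - a + 1)) - H (W k 0 (j - a))) ≤ a * (h k + e) :=
    mul_le_mul_of_nonneg_left h5.le (Nat.cast_nonneg a)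
  have h9 : (a : ℝ) * (h k - e) ≤ a * (h k - (H (W k' 0 n) / n - h k')) :=
    mul_le_mul_of_nonneg_left (by linarith) (Nat.cast_nonneg a)
  nlinarith

lemma info
    (P : Poly H)
    {O L V N Y : Finset (ℕ × ℕ)} (hOL : Dom (O ∪ L) Y) :
    (H (O ∪ (L ∪ V)) - H (L ∪ V)) - ((H (Y ∪ V) - H V) - (H (Y ∪ (V ∪ N)) - H (V ∪ N))) ≤
      H (O ∪ (L ∪ V ∪ N)) - H (L ∪ V ∪ N) := by
  have h1 := P.cond (A := N) (B := V) (B' := L ∪ V) (Dom.refl _).right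
  have h2 := P.cond (A := N) (B := O ∪ (L ∪ V)) (B' := Y ∪ V) (by
    rw [← Finset.union_assoc]
    exact hOL.left.union (Dom.refl _).right)
  have e1 : N ∪ (L ∪ V) = L ∪ V ∪ N := Finset.union_comm _ _
  have e2 : N ∪ V = V ∪ N := Finset.union_comm _ _
  have e3 : N ∪ (O ∪ (L ∪ V)) = O ∪ (L ∪ V ∪ N) := by
    ext x; simp; tauto
  have e4 : N ∪ (Y ∪ V) = Y ∪ (V ∪ N) := by ext x; simp; tauto
  rw [e1, e2] at h1
  rw [e3, e4] at h2
  linarith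

/-- The future windows. -/
def Lset (a : ℕ → ℕ) (κ j : ℕ) : Finset (ℕ × ℕ) :=
  (Finset.Ico κ j).biUnion fun i => W i (a i) (a (i + 1))

lemma telescope
    (P : Poly H)
    (hh : ∀ k, Tendsto (fun n => H (W k 0 (n + 1)) - H (W k 0 n)) atTop (nhds (h k)))
    (a : ℕ → ℕ) (ha : Monotone a) (η : ℕ → ℝ)
    (hη : ∀ k b, (H (W k 0 (a k) ∪ W k (a k) (a (k+1))) - H (W k (a k) (a (k+1)))) -
      (H (W k 0 (a k) ∪ (W k (a k) (a (k+1)) ∪ W (k+1) (a (k+1)) b)) -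
        H (W k (a k) (a (k+1)) ∪ W (k+1) (a (k+1)) b)) ≤ η k) (κ j : ℕ) (hj : κ ≤ j) :
    ∀ b, a j ≤ b →
    H (W 0 0 (a κ)) - (H (W κ 0 (a κ)) - a κ * h κ) - ∑ i ∈ Finset.Ico κ j, η i ≤
    H (W 0 0 (a κ) ∪ (Lset a κ j ∪ W j (a j) b)) - H (Lset a κ j ∪ W j (a j) b) := by
  induction j, hj using Nat.le_induction with
  | base =>
    intro b hb
    have := P.base hh (Nat.zero_le κ) hb
    simpa [Lset] using this
  | succ j hj ih =>
    intro b hb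
    have h1 := ih (a (j+1)) (ha (by omega))
    have e : Lset a κ (j+1) = Lset a κ j ∪ W j (a j) (a (j+1)) := by
      have e' : Finset.Ico κ (j+1) = insert j (Finset.Ico κ j) := by
        ext x; simp; omega
      rw [Lset, Lset, e', Finset.biUnion_insert, Finset.union_comm]
    have hd : Dom (W 0 0 (a κ) ∪ Lset a κ j) (W j 0 (a j)) := by
      apply (dom_W (by omega) le_rfl (ha hj)).union
      intro t l htl
      simp only [Lset, Finset.mem_biUnion, Finset.mem_Ico, mem_W] at htl
      obtain ⟨i, hi, h2, h3⟩ := htl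
      have := ha (show i + 1 ≤ j by omega)
      exact ⟨j, by rw [mem_W]; omega, by omega⟩
    have h2 := P.info (V := W j (a j) (a (j+1))) (N := W (j+1) (a (j+1)) b) hd
    have h3 := hη j b
    rw [Finset.sum_Ico_succ_top hj, e]
    linarith

end Poly

/-- The sequence of window lengths. -/
lemma Poly.main {H : Finset (ℕ × ℕ) → ℝ} (P : Poly H) (ε : ℕ → ℝ) (hε : ∀ k, 0 < ε k)
    (U : ℕ → ℕ → Prop) (hU : ∀ k, ∀ᶠ a in atTop, U k a) :
    ∃ a : ℕ → ℕ, (∀ k, (k + 1) * a k ≤ a (k + 1)) ∧ a 0 = 0 ∧ (∀ k, k < a (k + 1)) ∧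
      (∀ k, U (k + 1) (a (k + 1))) ∧
      ∀ K k, k < K → H (W 0 0 (a (k + 1))) - ε (k + 1) * a (k + 1) ≤
        H (W 0 0 (a (k + 1)) ∪ (Finset.range (K + 1)).biUnion fun j => W j (a j) ((j + 1) * a j)) -
        H (W 0 0 (a k) ∪ (Finset.range (K + 1)).biUnion fun j => W j (a j) ((j + 1) * a j)) := by
  obtain ⟨h, hh⟩ := P.exists_h
  have step : ∀ k x : ℕ, ∃ y : ℕ, (k + 1) * x ≤ y ∧ k < y ∧ U (k + 1) y ∧
      (∀ b, (H (W k 0 x ∪ W k x y) - H (W k x y)) -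
      (H (W k 0 x ∪ (W k x y ∪ W (k+1) y b)) - H (W k x y ∪ W (k+1) y b)) ≤ (1/2)^k) ∧
      H (W k 0 ((k + 1) * x)) ≤ ε (k+1) / 4 * y ∧
      H (W (k+1) 0 y) - y * h (k+1) ≤ ε (k+1) / 4 * y ∧
      2 ≤ ε (k+1) / 4 * y := by
    intro k x
    have hpos : 0 < ε (k+1) / 4 := by have := hε (k+1); positivity
    have t : Tendsto (fun y : ℕ => ε (k+1) / 4 * (y:ℝ)) atTop atTop :=
      tendsto_natCast_atTop_atTop.const_mul_atTop hpos
    have h1 := P.lemD hh (show k ≤ k + 1 by omega) x (show (0:ℝ) < (1/2)^k by positivity)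
    have h2 : ∀ᶠ n : ℕ in atTop, H (W (k+1) 0 n) / n < h (k+1) + ε (k+1) / 4 :=
      (P.rate hh (k+1)).eventually_lt_const (by linarith)
    obtain ⟨y, y1, y2, y3, y4, y5, y6, y7⟩ := ((eventually_ge_atTop ((k+1) * x)).and
      ((eventually_gt_atTop k).and ((hU (k+1)).and (h1.and ((t.eventually_ge_atTop _).and
      (h2.and (t.eventually_ge_atTop 2))))))).exists
    refine ⟨y, y1, y2, y3, y4, y5, ?_, y7⟩
    have hy : (0:ℝ) < y := by
      have : 0 < y := by omega
      exact_mod_cast this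
    rw [div_lt_iff₀ hy] at y6
    linarith
  choose f hf using step
  set a : ℕ → ℕ := fun n => Nat.rec 0 (fun k x => f k x) n with ha
  have ha1 : ∀ k, a (k+1) = f k (a k) := fun k => rfl
  have p1 : ∀ k, (k + 1) * a k ≤ a (k + 1) := fun k => by rw [ha1]; exact (hf k (a k)).1
  have hmono : Monotone a := by
    apply monotone_nat_of_le_succ
    intro k
    refine le_trans ?_ (p1 k)
    nlinarith [Nat.zero_le (a k)]
  refine ⟨a, p1, rfl, fun k => by rw [ha1]; exact (hf k (a k)).2.1,
    fun k => by rw [ha1]; exact (hf k (a k)).2.2.1, ?_⟩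
  intro K k hkK
  have q4 := P.telescope hh a hmono (fun k => (1/2)^k) (fun k b => by
    rw [ha1]; exact (hf k (a k)).2.2.2.1 b) (k+1) K hkK ((K+1) * a K)
    (by nlinarith [Nat.zero_le (a K)])
  have q5 := (hf k (a k)).2.2.2.2.1
  have q6 := (hf k (a k)).2.2.2.2.2.1
  have q7 := (hf k (a k)).2.2.2.2.2.2
  rw [← ha1] at q5 q6 q7
  have q8 : ∑ i ∈ Finset.Ico (k+1) K, ((1:ℝ)/2)^i ≤ 2 := by
    refine le_trans ?_ (sum_geometric_two_le K)
    apply Finset.sum_le_sum_of_subset_of_nonneg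
    · intro x; simp
    · intros; positivity
  set Γ := (Finset.range (K + 1)).biUnion fun j => W j (a j) ((j + 1) * a j) with hΓ
  set F := Poly.Lset a (k+1) K ∪ W K (a K) ((K+1) * a K) with hF
  set D := W k 0 ((k+1) * a k) with hD
  have hd : Dom (W 0 0 (a k) ∪ Γ) (D ∪ F) := by
    apply Dom.union
    · exact (dom_W (by omega) le_rfl (by nlinarith [Nat.zero_le (a k)])).left
    · intro t l htl
      simp only [hΓ, Finset.mem_biUnion, Finset.mem_range, mem_W] at htl
      obtain ⟨j, hj, h2, h3⟩ := htl
      by_cases hjk : j ≤ k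
      · refine ⟨k, ?_, by omega⟩
        rw [Finset.mem_union, hD, mem_W]
        left
        refine ⟨⟨by omega, lt_of_lt_of_le h2.2 ?_⟩, rfl⟩
        exact Nat.mul_le_mul (by omega) (hmono hjk)
      · by_cases hjK : j = K
        · subst hjK
          refine ⟨j, ?_, by omega⟩
          rw [Finset.mem_union, hF, Finset.mem_union]
          right; right; exact mem_W.2 ⟨h2, rfl⟩
        · refine ⟨j, ?_, by omega⟩
          rw [Finset.mem_union, hF, Finset.mem_union, Poly.Lset, Finset.mem_biUnion]
          right; left
          refine ⟨j, by rw [Finset.mem_Ico]; omega, ?_⟩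
          rw [mem_W]
          have := p1 j
          omega
  have c1 := P.cond (A := W 0 0 (a (k+1))) hd
  have c2 : W 0 0 (a (k+1)) ∪ (W 0 0 (a k) ∪ Γ) = W 0 0 (a (k+1)) ∪ Γ := by
    rw [← Finset.union_assoc]
    congr 1
    rw [Finset.union_eq_left]
    rintro ⟨t, l⟩ htl
    rw [mem_W] at htl ⊢
    have := hmono (show k ≤ k + 1 by omega)
    omega
  rw [c2] at c1
  have c3 : H (W 0 0 (a (k+1)) ∪ F) ≤ H (W 0 0 (a (k+1)) ∪ (D ∪ F)) :=
    P.mono _ _ (Dom.of_subset (by intro x; simp; tauto))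
  have c4 := P.sub2 D F
  linarith

end DC2


namespace DC2

section names
variable {X : Type*} (T : X → X) {β : ℕ → Type} [∀ k, Fintype (β k)] (Q : ∀ k, X → β k)

/-- The joint name of a point on a finite set of coordinates. -/
def nm (A : Finset (ℕ × ℕ)) (x : X) : ∀ p : A, β p.1.2 := fun p => Q p.1.2 (T^[p.1.1] x)

lemma nm_eq {A : Finset (ℕ × ℕ)} {x y : X} :
    nm T Q A x = nm T Q A y ↔ ∀ t l, (t, l) ∈ A → Q l (T^[t] x) = Q l (T^[t] y) := by
  constructor
  · intro h t l htl
    exact congrFun h ⟨(t, l), htl⟩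
  · intro h
    funext p
    exact h _ _ p.2

lemma poly_of (μ : FAM X) (hinv : ∀ s, μ.m (T ⁻¹' s) = μ.m s)
    (hQ : ∀ j k x y, j ≤ k → Q k x = Q k y → Q j x = Q j y) :
    Poly (fun A => μ.H (nm T Q A)) where
  h0 := by
    refine le_antisymm ?_ ?_
    · have := μ.H_mono (nm T Q ∅) (fun _ => ()) (fun x y _ => by rw [nm_eq]; simp)
      refine this.trans ?_
      simp [FAM.H, μ.univ]
    · exact Finset.sum_nonneg fun a _ => Real.negMulLog_nonneg (μ.nonneg _) (μ.le_one _)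
  mono A B h := by
    apply μ.H_mono
    intro x y
    rw [nm_eq, nm_eq]
    intro hB t l htl
    obtain ⟨l', h1, h2⟩ := h t l htl
    exact hQ l l' _ _ h2 (hB t l' h1)
  sub A B := by
    have h := μ.submod (nm T Q A) (nm T Q B) (nm T Q (A ∩ B))
    have e1 : μ.H (fun x => (nm T Q A x, nm T Q (A ∩ B) x)) = μ.H (nm T Q A) := by
      apply μ.H_congr
      intro x y
      simp only [Prod.mk.injEq, nm_eq, Finset.mem_inter]
      exact ⟨fun h => ⟨h, fun t l htl => h t l htl.1⟩, fun h => h.1⟩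
    have e2 : μ.H (fun x => (nm T Q B x, nm T Q (A ∩ B) x)) = μ.H (nm T Q B) := by
      apply μ.H_congr
      intro x y
      simp only [Prod.mk.injEq, nm_eq, Finset.mem_inter]
      exact ⟨fun h => ⟨h, fun t l htl => h t l htl.2⟩, fun h => h.1⟩
    have e3 : μ.H (fun x => (nm T Q A x, (nm T Q B x, nm T Q (A ∩ B) x))) =
        μ.H (nm T Q (A ∪ B)) := by
      apply μ.H_congr
      intro x y
      simp only [Prod.mk.injEq, nm_eq, Finset.mem_inter, Finset.mem_union]
      constructor
      · intro h
        exact ⟨fun t l htl => h t l (Or.inl htl), fun t l htl => h t l (Or.inr htl),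
          fun t l htl => h t l (Or.inl htl.1)⟩
      · rintro ⟨h1, h2, h3⟩ t l (htl | htl)
        · exact h1 t l htl
        · exact h2 t l htl
    rw [e1, e2, e3] at h
    exact h
  shift A := by
    have e : μ.H (nm T Q (A.image fun p => (p.1 + 1, p.2))) = μ.H (nm T Q A ∘ T) := by
      apply μ.H_congr
      intro x y
      simp only [Function.comp, nm_eq, Finset.mem_image, Prod.exists, Prod.mk.injEq]
      constructor
      · rintro h t l ⟨t', l', h1, rfl, rfl⟩
        exact h _ _ h1
      · intro h t l htl
        exact h _ _ ⟨t, l, htl, rfl, rfl⟩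
    show μ.H _ = μ.H _
    rw [e]
    unfold FAM.H
    refine Finset.sum_congr rfl fun a _ => ?_
    rw [Set.preimage_comp, hinv]

end names

namespace FAM
variable {X : Type*}

/-- pushforward -/
def map (μ : FAM X) (S : X → X) : FAM X where
  m s := μ.m (S ⁻¹' s)
  nonneg s := μ.nonneg _
  univ := by simp [μ.univ]
  add s t h := by
    rw [Set.preimage_union]
    exact μ.add _ _ (h.preimage S)

/-- finitely supported measures -/
noncomputable def ofWeights {ι : Type*} [Fintype ι] (c : ι → ℝ) (x : ι → X) (hc : ∀ i, 0 ≤ c i)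
    (h1 : ∑ i, c i = 1) : FAM X where
  m s := ∑ i, c i * s.indicator 1 (x i)
  nonneg s := Finset.sum_nonneg fun i _ =>
    mul_nonneg (hc i) (Set.indicator_nonneg (fun _ _ => by simp) _)
  univ := by simpa using h1
  add s t h := by
    rw [← Finset.sum_add_distrib]
    refine Finset.sum_congr rfl fun i _ => ?_
    rw [Set.indicator_union_of_disjoint h]
    ring

/-- Cesaro averages -/
noncomputable def avg (μ : FAM X) (T : X → X) (N : ℕ) (hN : 0 < N) : FAM X where
  m s := (∑ i ∈ Finset.range N, μ.m (T^[i] ⁻¹' s)) / N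
  nonneg s := div_nonneg (Finset.sum_nonneg fun i _ => μ.nonneg _) (Nat.cast_nonneg _)
  univ := by
    have : (N : ℝ) ≠ 0 := by positivity
    simp [μ.univ, this]
  add s t h := by
    rw [← add_div, ← Finset.sum_add_distrib]
    congr 1
    refine Finset.sum_congr rfl fun i _ => ?_
    rw [Set.preimage_union]
    exact μ.add _ _ (h.preimage _)

lemma avg_inv (μ : FAM X) (T : X → X) (N : ℕ) (hN : 0 < N) (s : Set X) :
    |(μ.avg T N hN).m (T ⁻¹' s) - (μ.avg T N hN).m s| ≤ 1 / N := by
  simp only [avg]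
  rw [← sub_div, ← Finset.sum_sub_distrib]
  have : ∀ i, μ.m (T^[i] ⁻¹' (T ⁻¹' s)) = μ.m (T^[i+1] ⁻¹' s) := by
    intro i
    rw [Function.iterate_succ', Set.preimage_comp]
  simp only [this]
  rw [Finset.sum_range_sub (fun i => μ.m (T^[i] ⁻¹' s)), abs_div, Nat.abs_cast]
  apply div_le_div_of_nonneg_right _ (Nat.cast_nonneg _)
  rw [abs_le]
  constructor <;> linarith [μ.nonneg (T^[N] ⁻¹' s), μ.le_one (T^[N] ⁻¹' s),
    μ.nonneg (T^[0] ⁻¹' s), μ.le_one (T^[0] ⁻¹' s)]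

lemma avg_H (μ : FAM X) (T : X → X) (N : ℕ) (hN : 0 < N) {α : Type*} [Fintype α] (f : X → α) :
    ∑ i ∈ Finset.range N, μ.H (f ∘ T^[i]) ≤ N * (μ.avg T N hN).H f := by
  have hN' : (0:ℝ) < N := by exact_mod_cast hN
  unfold H
  rw [Finset.sum_comm, Finset.mul_sum]
  refine Finset.sum_le_sum fun a _ => ?_
  have := Real.concaveOn_negMulLog.le_map_sum (t := Finset.range N) (w := fun _ => (1:ℝ)/N)
    (p := fun i => μ.m (T^[i] ⁻¹' (f ⁻¹' {a}))) (fun _ _ => by positivity)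
    (by simp; field_simp) (fun i _ => μ.nonneg _)
  simp only [smul_eq_mul, ← Finset.mul_sum] at this
  have e : (μ.avg T N hN).m (f ⁻¹' {a}) =
    1 / N * ∑ i ∈ Finset.range N, μ.m (T^[i] ⁻¹' (f ⁻¹' {a})) := by
    simp only [avg]; ring
  rw [e]
  have h2 := mul_le_mul_of_nonneg_left this hN'.le
  refine le_trans (le_of_eq ?_) h2
  rw [← mul_assoc]
  have : (N:ℝ) * (1 / N) = 1 := by field_simp
  rw [this, one_mul]
  rfl

lemma exists_ulim (F : ℕ → FAM X) : ∃ μ : FAM X, ∀ s,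
    Tendsto (fun N => (F N).m s) (hyperfilter ℕ : Filter ℕ) (nhds (μ.m s)) := by
  have : ∀ s, ∃ l, Tendsto (fun N => (F N).m s) (hyperfilter ℕ : Filter ℕ) (nhds l) := by
    intro s
    have hc : IsCompact (Set.Icc (0:ℝ) 1) := isCompact_Icc
    have := hc.ultrafilter_le_nhds ((hyperfilter ℕ).map fun N => (F N).m s) (by
      rw [le_principal_iff, Ultrafilter.mem_coe, Ultrafilter.mem_map]
      apply Filter.univ_mem'
      intro N
      exact ⟨(F N).nonneg s, (F N).le_one s⟩)
    obtain ⟨l, _, hl⟩ := this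
    exact ⟨l, hl⟩
  choose l hl using this
  refine ⟨⟨l, fun s => ?_, ?_, fun s t hst => ?_⟩, hl⟩
  · exact ge_of_tendsto' (hl s) fun N => (F N).nonneg s
  · have := hl Set.univ
    simp only [FAM.univ] at this
    exact tendsto_nhds_unique this tendsto_const_nhds
  · have h1 := hl (s ∪ t)
    simp only [fun N => (F N).add s t hst] at h1
    exact tendsto_nhds_unique h1 ((hl s).add (hl t))

lemma tendsto_H {F : ℕ → FAM X} {μ : FAM X} (h : ∀ s,
    Tendsto (fun N => (F N).m s) (hyperfilter ℕ : Filter ℕ) (nhds (μ.m s))) {α : Type*} [Fintype α]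
    (f : X → α) : Tendsto (fun N => (F N).H f) (hyperfilter ℕ : Filter ℕ) (nhds (μ.H f)) := by
  unfold H
  apply tendsto_finsetSum
  intro a _
  exact (Real.continuous_negMulLog.tendsto _).comp (h _)

end FAM
end DC2


namespace DC2

section press
variable {X : Type*} (T : X → X) {Λ : Type*} [Fintype Λ] (P : X → Λ) (w : Λ → ℝ)

/-- Names of length `n`. -/
def Nm (n : ℕ) (x : X) : Fin n → Λ := fun i => P (T^[i] x)

lemma Nm_eq {n : ℕ} {x y : X} :
    Nm T P n x = Nm T P n y ↔ ∀ i < n, P (T^[i] x) = P (T^[i] y) := by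
  constructor
  · intro h i hi; exact congrFun h ⟨i, hi⟩
  · intro h; funext i; exact h i i.2

open Classical in
/-- Indicator of realized names. -/
noncomputable def ind (n : ℕ) (u : Fin n → Λ) : ℝ := if ∃ x, Nm T P n x = u then 1 else 0

/-- The partition function. -/
noncomputable def Zf (n : ℕ) : ℝ := ∑ u : Fin n → Λ, ind T P n u * ∏ i, w (u i)

lemma ind_nonneg (n : ℕ) (u : Fin n → Λ) : 0 ≤ ind T P n u := by
  unfold ind; split_ifs <;> norm_num

variable {w}

lemma Zf_pos
    (hw : ∀ l, 0 < w l)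
    [Nonempty X] (n : ℕ) : 0 < Zf T P w n := by
  obtain ⟨x⟩ := ‹Nonempty X›
  apply Finset.sum_pos'
  · intro u _
    exact mul_nonneg (ind_nonneg T P n u) (Finset.prod_nonneg fun i _ => (hw _).le)
  · refine ⟨Nm T P n x, Finset.mem_univ _, ?_⟩
    rw [ind, if_pos ⟨x, rfl⟩, one_mul]
    exact Finset.prod_pos fun i _ => hw _

lemma Zf_add
    (hw : ∀ l, 0 < w l)
    (m n : ℕ) : Zf T P w (m + n) ≤ Zf T P w m * Zf T P w n := by
  have e : Zf T P w (m + n) = ∑ p : (Fin m → Λ) × (Fin n → Λ),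
      ind T P (m + n) (Fin.append p.1 p.2) * ∏ i, w (Fin.append p.1 p.2 i) := by
    rw [Zf, ← (Fin.appendEquiv m n).sum_comp]
    rfl
  rw [e, Fintype.sum_prod_type, Zf, Zf, Finset.sum_mul_sum]
  refine Finset.sum_le_sum fun u _ => Finset.sum_le_sum fun v _ => ?_
  dsimp only
  rw [Fin.prod_univ_add]
  simp only [Fin.append_left, Fin.append_right]
  have h1 : ind T P (m + n) (Fin.append u v) ≤ ind T P m u * ind T P n v := by
    unfold ind
    split_ifs with h1 h2 h3 h3 <;> try norm_num
    · obtain ⟨x, hx⟩ := h1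
      apply h3
      refine ⟨T^[m] x, ?_⟩
      funext i
      have := congrFun hx (Fin.natAdd m i)
      rw [Fin.append_right] at this
      rw [← this, Nm, Nm, ← Function.iterate_add_apply, Fin.val_natAdd, add_comm]
    all_goals
      obtain ⟨x, hx⟩ := h1
      apply h2
      refine ⟨x, ?_⟩
      funext i
      have := congrFun hx (Fin.castAdd n i)
      rw [Fin.append_left] at this
      rw [← this, Nm, Nm, Fin.val_castAdd]
  have h2 : 0 ≤ (∏ i, w (u i)) * ∏ i, w (v i) :=
    mul_nonneg (Finset.prod_nonneg fun i _ => (hw _).le) (Finset.prod_nonneg fun i _ => (hw _).le)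
  calc _ ≤ (ind T P m u * ind T P n v) * ((∏ i, w (u i)) * ∏ i, w (v i)) :=
        mul_le_mul_of_nonneg_right h1 h2
    _ = _ := by ring

lemma subadd
    (hw : ∀ l, 0 < w l)
    [Nonempty X] : Subadditive fun n => Real.log (Zf T P w n) := by
  intro m n
  rw [← Real.log_mul (Zf_pos T P hw m).ne' (Zf_pos T P hw n).ne']
  exact Real.log_le_log (Zf_pos T P hw _) (Zf_add T P hw m n)

lemma Zf_bdd
    (hw : ∀ l, 0 < w l)
    [Nonempty X] : BddBelow (Set.range fun n : ℕ => Real.log (Zf T P w n) / n) := by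
  refine ⟨-∑ l, |Real.log (w l)|, ?_⟩
  rintro _ ⟨n, rfl⟩
  dsimp only
  have hS : 0 ≤ ∑ l, |Real.log (w l)| := Finset.sum_nonneg fun _ _ => abs_nonneg _
  rcases Nat.eq_zero_or_pos n with rfl | hn
  · simpa using hS
  have hn' : (0:ℝ) < n := by exact_mod_cast hn
  rw [le_div_iff₀ hn']
  obtain ⟨x⟩ := ‹Nonempty X›
  have h1 : ∏ i, w (Nm T P n x i) ≤ Zf T P w n := by
    have h2 := Finset.single_le_sum (f := fun u : Fin n → Λ => ind T P n u * ∏ i, w (u i))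
      (fun u _ => mul_nonneg (ind_nonneg T P n u) (Finset.prod_nonneg fun i _ => (hw _).le))
      (Finset.mem_univ (Nm T P n x))
    have h3 : ind T P n (Nm T P n x) = 1 := if_pos ⟨x, rfl⟩
    simp only [h3, one_mul] at h2
    exact h2
  have h4 := Real.log_le_log (Finset.prod_pos fun i _ => hw _) h1
  rw [Real.log_prod (fun i _ => (hw _).ne')] at h4
  refine le_trans ?_ h4
  have h5 : ∀ i : Fin n, -∑ l, |Real.log (w l)| ≤ Real.log (w (Nm T P n x i)) := by
    intro i
    have := Finset.single_le_sum (f := fun l => |Real.log (w l)|)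
      (fun u _ => abs_nonneg _) (Finset.mem_univ (Nm T P n x i))
    have h6 := neg_abs_le (Real.log (w (Nm T P n x i)))
    linarith
  have := Finset.card_nsmul_le_sum Finset.univ (fun i : Fin n => Real.log (w (Nm T P n x i))) _
    (fun i _ => h5 i)
  simp only [Finset.card_univ, Fintype.card_fin, nsmul_eq_mul] at this
  linarith

/-- The equilibrium finite measure. -/
lemma exists_muN
    (hw : ∀ l, 0 < w l)
    [Nonempty X] (N : ℕ) : ∃ μ : FAM X,
    Real.log (Zf T P w N) = μ.H (Nm T P N) +
      ∑ i ∈ Finset.range N, ∑ l, μ.m (T^[i] ⁻¹' (P ⁻¹' {l})) * Real.log (w l) := by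
  classical
  have hZ := Zf_pos T P hw N
  set Z := Zf T P w N with hZd
  set c : (Fin N → Λ) → ℝ := fun u => ind T P N u * (∏ i, w (u i)) / Z with hc
  have hc0 : ∀ u, 0 ≤ c u := fun u => div_nonneg (mul_nonneg (ind_nonneg T P N u)
    (Finset.prod_nonneg fun i _ => (hw _).le)) hZ.le
  have hc1 : ∑ u, c u = 1 := by
    rw [hc, ← Finset.sum_div]
    exact div_self hZ.ne'
  set xx : (Fin N → Λ) → X := fun u =>
    if h : ∃ x, Nm T P N x = u then h.choose else Classical.arbitrary X with hxx
  have hcx : ∀ u, c u ≠ 0 → Nm T P N (xx u) = u := by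
    intro u hu
    by_cases h : ∃ x, Nm T P N x = u
    · rw [hxx]; simp only [dif_pos h]; exact h.choose_spec
    · exfalso; apply hu
      simp [hc, ind, h]
  set μ := FAM.ofWeights c xx hc0 hc1 with hμ
  have m1 : ∀ (u : Fin N → Λ), μ.m (Nm T P N ⁻¹' {u}) = c u := by
    intro u
    show ∑ v, c v * _ = _
    rw [Finset.sum_eq_single u]
    · by_cases h : c u = 0
      · simp [h]
      · simp [Set.indicator, hcx u h]
    · intro v _ hvu
      by_cases h : c v = 0
      · simp [h]
      · simp [Set.indicator, hcx v h, hvu]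
    · simp
  refine ⟨μ, ?_⟩
  have m2 : ∀ i (hi : i < N), ∑ l, μ.m (T^[i] ⁻¹' (P ⁻¹' {l})) * Real.log (w l) =
      ∑ u, c u * Real.log (w (u ⟨i, hi⟩)) := by
    intro i hi
    have : ∀ l, μ.m (T^[i] ⁻¹' (P ⁻¹' {l})) = ∑ u, c u * (if u ⟨i, hi⟩ = l then 1 else 0) := by
      intro l
      show ∑ u, c u * _ = _
      refine Finset.sum_congr rfl fun u _ => ?_
      by_cases h : c u = 0
      · simp [h]
      · have h2 := congrFun (hcx u h) ⟨i, hi⟩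
        simp only [Nm] at h2
        simp [Set.indicator, h2]
    simp only [this, Finset.sum_mul]
    rw [Finset.sum_comm]
    refine Finset.sum_congr rfl fun u _ => ?_
    simp
  have m3 : ∑ i ∈ Finset.range N, ∑ l, μ.m (T^[i] ⁻¹' (P ⁻¹' {l})) * Real.log (w l) =
      ∑ u, c u * ∑ i : Fin N, Real.log (w (u i)) := by
    have h1 : ∑ u, c u * ∑ i : Fin N, Real.log (w (u i)) =
        ∑ i : Fin N, ∑ u, c u * Real.log (w (u i)) := by
      simp only [Finset.mul_sum]
      exact Finset.sum_comm
    rw [h1, Finset.sum_range (fun i => ∑ l, μ.m (T^[i] ⁻¹' (P ⁻¹' {l})) * Real.log (w l))]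
    refine Finset.sum_congr rfl fun i _ => ?_
    exact m2 i i.2
  rw [m3, FAM.H, ← Finset.sum_add_distrib]
  have m4 : ∀ u, Real.negMulLog (μ.m (Nm T P N ⁻¹' {u})) + c u * ∑ i : Fin N, Real.log (w (u i))
      = c u * Real.log Z := by
    intro u
    rw [m1]
    by_cases h : c u = 0
    · simp [h]
    · have hi : ind T P N u = 1 := by
        by_contra h'
        apply h
        have : ind T P N u = 0 := by
          unfold ind at h' ⊢
          split_ifs at h' ⊢ <;> simp_all
        simp [hc, this]
      have hcu : Real.log (c u) = ∑ i : Fin N, Real.log (w (u i)) - Real.log Z := by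
        simp only [hc, hi, one_mul]
        rw [Real.log_div (Finset.prod_pos fun i _ => hw _).ne' hZ.ne',
          Real.log_prod (fun i _ => (hw _).ne')]
      rw [Real.negMulLog, hcu]; ring
  simp only [m4, ← Finset.sum_mul, hc1, one_mul]

lemma sum_shift_aux
    (S : ℕ → ℝ) (hS : Monotone S) (n N : ℕ) :
    n * S N - n * S n ≤ ∑ i ∈ Finset.range N, (S (i + n) - S i) := by
  have h1 := Finset.sum_range_add S N n
  have h2 := Finset.sum_range_add S n N
  rw [add_comm n N] at h2
  rw [Finset.sum_sub_distrib]
  have h3 : ∑ i ∈ Finset.range N, S (i + n) = ∑ i ∈ Finset.range N, S (n + i) := by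
    simp only [add_comm]
  have h4 : n * S N ≤ ∑ i ∈ Finset.range n, S (N + i) := by
    have := Finset.card_nsmul_le_sum (Finset.range n) (fun i => S (N + i)) (S N)
      (fun i _ => hS (by omega))
    simpa using this
  have h5 : ∑ i ∈ Finset.range n, S i ≤ n * S n := by
    have := Finset.sum_le_card_nsmul (Finset.range n) S (S n)
      (fun i hi => hS (Finset.mem_range.1 hi).le)
    simpa using this
  linarith

/-- The equilibrium state. -/
lemma exists_equilibrium
    (hw : ∀ l, 0 < w l)
    [Nonempty X] : ∃ μ : FAM X, (∀ s, μ.m (T ⁻¹' s) = μ.m s) ∧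
    ∀ n : ℕ, n * (subadd T P hw).lim ≤
      μ.H (Nm T P n) + n * ∑ l, μ.m (P ⁻¹' {l}) * Real.log (w l) := by
  choose ν hν using fun N : ℕ => exists_muN T P hw (N + 1)
  set F : ℕ → FAM X := fun N => (ν N).avg T (N + 1) (Nat.succ_pos N) with hF
  obtain ⟨μ, hμ⟩ := FAM.exists_ulim F
  have hcof : (hyperfilter ℕ : Filter ℕ) ≤ atTop := Nat.hyperfilter_le_atTop
  have t0 : ∀ C : ℝ, Tendsto (fun N : ℕ => C / ((N + 1 : ℕ) : ℝ)) (hyperfilter ℕ : Filter ℕ)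
      (nhds 0) := by
    intro C
    exact ((tendsto_const_div_atTop_nhds_zero_nat C).comp (tendsto_add_atTop_nat 1)).mono_left hcof
  refine ⟨μ, ?_, ?_⟩
  · intro s
    have h1 := (hμ (T ⁻¹' s)).sub (hμ s)
    have h2 : Tendsto (fun N => (F N).m (T ⁻¹' s) - (F N).m s) (hyperfilter ℕ : Filter ℕ)
        (nhds 0) := by
      apply squeeze_zero_norm _ (t0 1)
      intro N
      exact FAM.avg_inv _ _ _ _ _
    have := tendsto_nhds_unique h1 h2
    linarith
  · intro n
    have key : ∀ N : ℕ, n * (subadd T P hw).lim ≤ (F N).H (Nm T P n) +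
        n * ∑ l, (F N).m (P ⁻¹' {l}) * Real.log (w l) +
        n * Real.log (Fintype.card (Fin n → Λ)) / ((N + 1 : ℕ) : ℝ) := by
      intro N
      have hNp : (0:ℝ) < ((N + 1 : ℕ) : ℝ) := by positivity
      obtain ⟨x0⟩ := ‹Nonempty X›
      haveI : Nonempty (Fin n → Λ) := ⟨Nm T P n x0⟩
      have a1 : ((N + 1 : ℕ) : ℝ) * (subadd T P hw).lim ≤ Real.log (Zf T P w (N + 1)) := by
        haveI : Nonempty X := ⟨x0⟩
        have hb := Zf_bdd T P hw
        have := (subadd T P hw).lim_le_div hb (Nat.succ_ne_zero N)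
        rwa [le_div_iff₀ hNp, mul_comm] at this
      set S : ℕ → ℝ := fun t => (ν N).H (Nm T P t) with hS
      have hSm : Monotone S := by
        intro s t hst
        apply (ν N).H_mono
        intro x y
        rw [Nm_eq, Nm_eq]
        intro h i hi
        exact h i (by omega)
      have a2 := sum_shift_aux S hSm n (N + 1)
      have a3 : ∀ i, S (i + n) - S i ≤ (ν N).H (Nm T P n ∘ T^[i]) := by
        intro i
        have h1 := (ν N).submod (Nm T P i) (Nm T P n ∘ T^[i]) (fun _ => ())
        have h2 : S (i + n) ≤ (ν N).H (fun x => (Nm T P i x, ((Nm T P n ∘ T^[i]) x, ()))) := by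
          apply (ν N).H_mono
          intro x y
          simp only [Prod.mk.injEq, Function.comp, Nm_eq, and_true, ← Function.iterate_add_apply]
          rintro ⟨h3, h4⟩ j hj
          by_cases hji : j < i
          · exact h3 j hji
          · have := h4 (j - i) (by omega)
            rwa [Nat.sub_add_cancel (by omega)] at this
        have h3 : (ν N).H (fun x => (Nm T P i x, ())) = S i := by
          apply (ν N).H_congr; simp
        have h4 : (ν N).H (fun x => ((Nm T P n ∘ T^[i]) x, ())) = (ν N).H (Nm T P n ∘ T^[i]) := by
          apply (ν N).H_congr; simp
        have h5 : 0 ≤ (ν N).H (fun _ => ()) :=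
          Finset.sum_nonneg fun a _ => Real.negMulLog_nonneg ((ν N).nonneg _) ((ν N).le_one _)
        rw [h3, h4] at h1
        linarith
      have a4 := (ν N).avg_H T (N + 1) (Nat.succ_pos N) (Nm T P n)
      have a5 := Finset.sum_le_sum fun i (_ : i ∈ Finset.range (N + 1)) => a3 i
      have a6 : S n ≤ Real.log (Fintype.card (Fin n → Λ)) := (ν N).H_le_log_card _
      have a7 : ∑ i ∈ Finset.range (N + 1), ∑ l, (ν N).m (T^[i] ⁻¹' (P ⁻¹' {l})) * Real.log (w l)
          = ((N + 1 : ℕ) : ℝ) * ∑ l, (F N).m (P ⁻¹' {l}) * Real.log (w l) := by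
        rw [Finset.sum_comm, Finset.mul_sum]
        refine Finset.sum_congr rfl fun l _ => ?_
        rw [← Finset.sum_mul, hF]
        simp only [FAM.avg]
        rw [← mul_assoc, mul_div_cancel₀ _ hNp.ne']
      have a8 := hν N
      rw [a7] at a8
      have a9 : S (N + 1) = (ν N).H (Nm T P (N + 1)) := rfl
      rw [a8, ← a9] at a1
      have hn0 : (0:ℝ) ≤ n := Nat.cast_nonneg n
      have b1 := mul_le_mul_of_nonneg_left a1 hn0
      have b2 := mul_le_mul_of_nonneg_left a6 hn0
      rw [← sub_le_iff_le_add', le_div_iff₀ hNp]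
      have e : (F N).H (Nm T P n) = ((ν N).avg T (N + 1) (Nat.succ_pos N)).H (Nm T P n) := rfl
      rw [e]
      nlinarith
    have lim1 := ((FAM.tendsto_H hμ (Nm T P n)).add
      ((tendsto_finsetSum Finset.univ (fun l _ => (hμ (P ⁻¹' {l})).mul_const
        (Real.log (w l)))).const_mul (n:ℝ))).add
      (t0 (n * Real.log (Fintype.card (Fin n → Λ))))
    rw [add_zero] at lim1
    exact ge_of_tendsto' lim1 key

end press
end DC2


namespace DC2

section count
variable {Λ : Type*} [Fintype Λ]

open Classical in
/-- Separation of names. -/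
def Sep (far : Λ → Λ → Prop) (δ : ℝ) {n : ℕ} (u z : Fin n → Λ) : Prop :=
  δ * n ≤ ((Finset.univ.filter fun i => far (u i) (z i)).card : ℝ)

lemma Sep.symm {far : Λ → Λ → Prop} (hf : ∀ a b, far a b → far b a) {δ : ℝ} {n : ℕ}
    {u z : Fin n → Λ} (h : Sep far δ u z) : Sep far δ z u := by
  unfold Sep at *
  refine h.trans ?_
  norm_cast
  apply Finset.card_le_card
  intro i
  simp only [Finset.mem_filter, Finset.mem_univ, true_and]
  exact hf _ _

open Classical in
lemma count_one {w : Λ → ℝ} {far : Λ → Λ → Prop} {L δ : ℝ} (hL : 0 ≤ L) (hw : ∀ l, 0 < w l)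
    (hw1 : ∀ l, w l ≤ 1)
    (hone : ∀ l' l₁ l₂, ¬ far l₁ l' → ¬ far l₂ l' → w l₁ ≠ Real.exp (-L) →
      w l₂ ≠ Real.exp (-L) → l₁ = l₂) {n : ℕ} (z : Fin n → Λ) :
    ∑ u ∈ (Finset.univ.filter fun u : Fin n → Λ => ¬ Sep far δ u z), ∏ i, w (u i) ≤
      ((1 + Fintype.card Λ * Real.exp (-L)) * Real.exp (L * δ)) ^ n := by
  set θ : Λ → Λ → ℝ := fun l l' => if far l l' then Real.exp (-L) else w l with hθ
  have hθ0 : ∀ l l', 0 ≤ θ l l' := by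
    intro l l'; simp only [hθ]; split_ifs
    · positivity
    · exact (hw l).le
  have hsum : ∀ l', ∑ l, θ l l' ≤ 1 + Fintype.card Λ * Real.exp (-L) := by
    intro l'
    have h1 : ∀ l, θ l l' ≤ (if (¬ far l l' ∧ w l ≠ Real.exp (-L)) then 1 else 0)
        + Real.exp (-L) := by
      intro l
      simp only [hθ]
      by_cases hf : far l l'
      · simp [hf]
      · by_cases hh : w l = Real.exp (-L)
        · simp [hf, hh]
        · simp only [hf, hh, if_false, not_false_eq_true, ne_eq, and_self, if_true]
          linarith [hw1 l, Real.exp_pos (-L)]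
    refine (Finset.sum_le_sum fun l _ => h1 l).trans ?_
    rw [Finset.sum_add_distrib]
    have h2 : ∑ l, (if (¬ far l l' ∧ w l ≠ Real.exp (-L)) then (1:ℝ) else 0) ≤ 1 := by
      rw [Finset.sum_boole]
      norm_cast
      rw [Finset.card_le_one]
      simp only [Finset.mem_filter, Finset.mem_univ, true_and]
      rintro a ⟨ha, ha'⟩ b ⟨hb, hb'⟩
      exact hone l' a b ha hb ha' hb'
    simp only [Finset.sum_const, Finset.card_univ, nsmul_eq_mul]
    linarith
  have hpt : ∀ u : Fin n → Λ, ¬ Sep far δ u z →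
      ∏ i, w (u i) ≤ (∏ i, θ (u i) (z i)) * Real.exp (L * δ) ^ n := by
    intro u hu
    have h1 : ∀ l l', w l ≤ θ l l' * (if far l l' then Real.exp L else 1) := by
      intro l l'
      simp only [hθ]
      split_ifs
      · rw [← Real.exp_add]; simp [hw1 l]
      · simp
    have h2 : ∏ i, w (u i) ≤
        ∏ i, (θ (u i) (z i) * (if far (u i) (z i) then Real.exp L else 1)) :=
      Finset.prod_le_prod (fun i _ => (hw _).le) fun i _ => h1 _ _
    refine h2.trans ?_
    rw [Finset.prod_mul_distrib]
    apply mul_le_mul_of_nonneg_left _ (Finset.prod_nonneg fun i _ => hθ0 _ _)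
    rw [Finset.prod_ite]
    simp only [Finset.prod_const, one_pow, mul_one]
    rw [← Real.exp_nat_mul, ← Real.exp_nat_mul, Real.exp_le_exp]
    unfold Sep at hu
    push Not at hu
    nlinarith
  calc _ ≤ ∑ u ∈ (Finset.univ.filter fun u : Fin n → Λ => ¬ Sep far δ u z),
        (∏ i, θ (u i) (z i)) * Real.exp (L * δ) ^ n := by
        apply Finset.sum_le_sum
        intro u hu
        exact hpt u (Finset.mem_filter.1 hu).2
    _ ≤ ∑ u : Fin n → Λ, (∏ i, θ (u i) (z i)) * Real.exp (L * δ) ^ n := by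
        apply Finset.sum_le_sum_of_subset_of_nonneg (Finset.filter_subset _ _)
        intro u _ _
        exact mul_nonneg (Finset.prod_nonneg fun i _ => hθ0 _ _) (by positivity)
    _ = (∏ i, ∑ l, θ l (z i)) * Real.exp (L * δ) ^ n := by
        rw [← Finset.sum_mul, Fintype.prod_sum]
    _ ≤ (1 + Fintype.card Λ * Real.exp (-L)) ^ n * Real.exp (L * δ) ^ n := by
        apply mul_le_mul_of_nonneg_right _ (by positivity)
        refine (Finset.prod_le_prod (fun i _ => Finset.sum_nonneg fun l _ => hθ0 l (z i))
          fun i _ => hsum (z i)).trans ?_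
        simp
    _ = _ := by rw [mul_pow]

end count

section step
variable {X : Type*} (T : X → X) {Λ : Type*} [Fintype Λ] (P : X → Λ)

lemma FAM.sum_push (μ : FAM X) {α γ : Type*} [Fintype α] [Fintype γ] (f : X → α) (φ : α → γ)
    (F : γ → ℝ) : ∑ o, μ.m (f ⁻¹' {o}) * F (φ o) = ∑ l, μ.m ((fun x => φ (f x)) ⁻¹' {l}) * F l := by
  classical
  have : ∀ l, μ.m ((fun x => φ (f x)) ⁻¹' {l}) =
      ∑ o, if φ o = l then μ.m (f ⁻¹' {o}) else 0 := by
    intro l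
    rw [← μ.iUnion_fiber f]
    refine Finset.sum_congr rfl fun o _ => ?_
    split_ifs with h
    · congr 1; ext x; simp; rintro rfl; exact h
    · have : (fun x => φ (f x)) ⁻¹' {l} ∩ f ⁻¹' {o} = ∅ := by
        ext x; simp; rintro h1 rfl; exact h h1
      rw [this, μ.empty]
  simp only [this, Finset.sum_mul]
  rw [Finset.sum_comm]
  refine Finset.sum_congr rfl fun o _ => ?_
  simp

lemma FAM.inv_iter (μ : FAM X) (hinv : ∀ s, μ.m (T ⁻¹' s) = μ.m s) (i : ℕ) (s : Set X) :
    μ.m (T^[i] ⁻¹' s) = μ.m s := by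
  induction i generalizing s with
  | zero => rfl
  | succ i ih => rw [Function.iterate_succ', Set.preimage_comp, ih, hinv]

lemma FAM.sum_log (μ : FAM X) (hinv : ∀ s, μ.m (T ⁻¹' s) = μ.m s) {w : Λ → ℝ}
    (hw : ∀ l, 0 < w l) (n : ℕ) :
    ∑ o, μ.m (Nm T P n ⁻¹' {o}) * Real.log (∏ i, w (o i)) =
      n * ∑ l, μ.m (P ⁻¹' {l}) * Real.log (w l) := by
  have h1 : ∀ o : Fin n → Λ, Real.log (∏ i, w (o i)) = ∑ i, Real.log (w (o i)) := fun o =>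
    Real.log_prod (fun i _ => (hw _).ne')
  simp only [h1, Finset.mul_sum]
  rw [Finset.sum_comm]
  have h2 : ∀ i : Fin n, ∑ o, μ.m (Nm T P n ⁻¹' {o}) * Real.log (w (o i)) =
      ∑ l, μ.m (P ⁻¹' {l}) * Real.log (w l) := by
    intro i
    rw [μ.sum_push (Nm T P n) (fun o => o i) (fun l => Real.log (w l))]
    refine Finset.sum_congr rfl fun l _ => ?_
    rw [← μ.inv_iter T hinv i (P ⁻¹' {l})]
    rfl
  simp only [h2]
  simp [Finset.mul_sum]

lemma sum_biUnion_le_aux {ι κ : Type*} [DecidableEq κ] (s : Finset ι) (t : ι → Finset κ)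
    (f : κ → ℝ) (hf : ∀ u, 0 ≤ f u) : ∑ u ∈ s.biUnion t, f u ≤ ∑ z ∈ s, ∑ u ∈ t z, f u := by
  classical
  induction s using Finset.induction_on with
  | empty => simp
  | insert a s ha ih =>
    rw [Finset.biUnion_insert, Finset.sum_insert ha]
    have := Finset.sum_union_inter (s₁ := t a) (s₂ := s.biUnion t) (f := f)
    have h2 : 0 ≤ ∑ u ∈ t a ∩ s.biUnion t, f u := Finset.sum_nonneg fun u _ => hf u
    linarith

lemma step_est [Nonempty X] (μ : FAM X) (hinv : ∀ s, μ.m (T ⁻¹' s) = μ.m s)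
    {w : Λ → ℝ} {far : Λ → Λ → Prop} {L δ : ℝ} (hL : 0 ≤ L) (hw : ∀ l, 0 < w l)
    (hw1 : ∀ l, w l ≤ 1)
    (hone : ∀ l' l₁ l₂, ¬ far l₁ l' → ¬ far l₂ l' → w l₁ ≠ Real.exp (-L) →
      w l₂ ≠ Real.exp (-L) → l₁ = l₂)
    {γ : Type*} [Fintype γ] (g : X → γ) (a n : ℕ) (hn : 0 < n) (Good : X → Prop)
    (p ε Y : ℝ) (hY : Y = n * ((1 + Fintype.card Λ * Real.exp (-L)) * Real.exp (L * δ)) ^ a)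
    (hYZ : Real.log Y ≤ Real.log (Zf T P w a))
    (hZ : Real.log (Zf T P w a) ≤ a * (p + ε))
    (hlow : μ.H (Nm T P a) - ε * a ≤ μ.H (fun x => (Nm T P a x, g x)) - μ.H g)
    (heq : a * p ≤ μ.H (Nm T P a) + a * ∑ l, μ.m (P ⁻¹' {l}) * Real.log (w l)) :
    μ.m {x | Good x ∧ ¬ (∀ Z : Finset X, Z.card ≤ n → ∃ y, g y = g x ∧ Good y ∧
      ∀ z ∈ Z, Sep far δ (Nm T P a y) (Nm T P a z))} *
      (Real.log (Zf T P w a) - Real.log Y) ≤ Real.log 2 + 2 * ε * a := by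
  classical
  set prev : X → Prop := fun x => ∀ Z : Finset X, Z.card ≤ n → ∃ y, g y = g x ∧ Good y ∧
      ∀ z ∈ Z, Sep far δ (Nm T P a y) (Nm T P a z) with hprev
  set B : (Fin a → Λ) → γ → Prop := fun o b => ∃ x, Nm T P a x = o ∧ g x = b ∧ Good x ∧ ¬ prev x
    with hB
  have hZ0 := Zf_pos T P hw a
  set Z := Zf T P w a with hZd
  have hY0 : 0 < Y := by
    rw [hY]
    have : (0:ℝ) < n := by exact_mod_cast hn
    positivity
  have hpw : ∀ o : Fin a → Λ, 0 < ∏ i, w (o i) := fun o => Finset.prod_pos fun i _ => hw _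
  have hcount : ∀ b, ∑ o, (if B o b then ∏ i, w (o i) else 0) ≤ Y := by
    intro b
    by_cases hex : ∃ o, B o b
    · obtain ⟨o0, x0, -, hx0, -, hx1⟩ := hex
      simp only [hprev] at hx1
      push Not at hx1
      obtain ⟨Zs, hZs, hZs2⟩ := hx1
      rw [← Finset.sum_filter]
      have hsub : (Finset.univ.filter fun o => B o b) ⊆
          Zs.biUnion fun z => Finset.univ.filter fun u => ¬ Sep far δ u (Nm T P a z) := by
        intro o ho
        obtain ⟨x, hx1, hx2, hx3, -⟩ := (Finset.mem_filter.1 ho).2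
        obtain ⟨z, hz, hz2⟩ := hZs2 x (hx2.trans hx0.symm) hx3
        rw [hx1] at hz2
        simp only [Finset.mem_biUnion, Finset.mem_filter, Finset.mem_univ, true_and]
        exact ⟨z, hz, hz2⟩
      calc _ ≤ ∑ u ∈ Zs.biUnion fun z => Finset.univ.filter fun u => ¬ Sep far δ u (Nm T P a z),
            ∏ i, w (u i) :=
            Finset.sum_le_sum_of_subset_of_nonneg hsub fun u _ _ => (hpw u).le
        _ ≤ ∑ z ∈ Zs, ∑ u ∈ Finset.univ.filter fun u => ¬ Sep far δ u (Nm T P a z),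
            ∏ i, w (u i) := by
            exact sum_biUnion_le_aux _ _ _ fun u => (hpw u).le
        _ ≤ ∑ z ∈ Zs, ((1 + Fintype.card Λ * Real.exp (-L)) * Real.exp (L * δ)) ^ a :=
            Finset.sum_le_sum fun z _ => count_one hL hw hw1 hone _
        _ ≤ Y := by
            rw [Finset.sum_const, nsmul_eq_mul, hY]
            apply mul_le_mul_of_nonneg_right _ (by positivity)
            exact_mod_cast hZs
    · push Not at hex
      simp [hex, hY0.le]
  set q : (Fin a → Λ) → γ → ℝ := fun o b =>
    if B o b then (∏ i, w (o i)) / (2 * Y) else ind T P a o * (∏ i, w (o i)) / (2 * Z) with hq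
  have hind : ∀ (o : Fin a → Λ) (b : γ), μ.m ((fun x => (Nm T P a x, g x)) ⁻¹' {(o, b)}) ≠ 0 →
      ind T P a o = 1 := by
    intro o b h
    obtain ⟨x, hx⟩ := μ.nonempty_of_ne h
    simp at hx
    exact if_pos ⟨x, hx.1⟩
  have G := μ.gibbs (Nm T P a) g q
    (fun o b => by
      simp only [hq]
      have := hpw o
      have := ind_nonneg T P a o
      split_ifs <;> positivity)
    (fun b => by
      have h1 : ∀ o, q o b ≤ (if B o b then ∏ i, w (o i) else 0) / (2 * Y) +
          ind T P a o * (∏ i, w (o i)) / (2 * Z) := by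
        intro o
        simp only [hq]
        have := hpw o
        have := ind_nonneg T P a o
        have : 0 ≤ ind T P a o * (∏ i, w (o i)) / (2 * Z) := by positivity
        split_ifs
        · linarith
        · simp
      refine (Finset.sum_le_sum fun o _ => h1 o).trans ?_
      rw [Finset.sum_add_distrib, ← Finset.sum_div, ← Finset.sum_div]
      have h2 : (∑ o, (if B o b then ∏ i, w (o i) else 0)) / (2 * Y) ≤ 1 / 2 := by
        rw [div_le_div_iff₀ (by positivity) (by norm_num)]
        linarith [hcount b]
      have h3 : (∑ o, ind T P a o * (∏ i, w (o i))) / (2 * Z) = 1 / 2 := by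
        have : ∑ o, ind T P a o * (∏ i, w (o i)) = Z := rfl
        rw [this]; field_simp
      linarith)
    (fun o b h => by
      simp only [hq, hind o b h]
      have := hpw o
      split_ifs <;> positivity)
  have hterm : ∀ o b, μ.m ((fun x => (Nm T P a x, g x)) ⁻¹' {(o, b)}) * (- Real.log (q o b)) =
      μ.m ((fun x => (Nm T P a x, g x)) ⁻¹' {(o, b)}) * (Real.log 2 + Real.log Z)
      - μ.m ((fun x => (Nm T P a x, g x)) ⁻¹' {(o, b)}) * Real.log (∏ i, w (o i))
      - (if B o b then μ.m ((fun x => (Nm T P a x, g x)) ⁻¹' {(o, b)}) else 0) *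
        (Real.log Z - Real.log Y) := by
    intro o b
    by_cases h : μ.m ((fun x => (Nm T P a x, g x)) ⁻¹' {(o, b)}) = 0
    · simp [h]
    · simp only [hq, hind o b h, one_mul]
      have h1 := hpw o
      split_ifs
      · rw [Real.log_div h1.ne' (by positivity), Real.log_mul (by norm_num) hY0.ne']
        ring
      · rw [Real.log_div h1.ne' (by positivity), Real.log_mul (by norm_num) hZ0.ne']
        ring
  simp only [hterm, Finset.sum_sub_distrib, ← Finset.sum_mul] at G
  have e1 : ∑ o, ∑ b, μ.m ((fun x => (Nm T P a x, g x)) ⁻¹' {(o, b)}) = 1 := by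
    simp only [μ.marg_left, μ.sum_fiber]
  have e2 : ∑ o, (∑ b, μ.m ((fun x => (Nm T P a x, g x)) ⁻¹' {(o, b)})) *
      Real.log (∏ i, w (o i)) = a * ∑ l, μ.m (P ⁻¹' {l}) * Real.log (w l) := by
    simp only [μ.marg_left]
    exact μ.sum_log T P hinv hw a
  rw [e1, e2] at G
  have e3 : μ.m {x | Good x ∧ ¬ prev x} ≤
      ∑ o, ∑ b, (if B o b then μ.m ((fun x => (Nm T P a x, g x)) ⁻¹' {(o, b)}) else 0) := by
    rw [← μ.iUnion_fiber (fun x => (Nm T P a x, g x)), Fintype.sum_prod_type]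
    refine Finset.sum_le_sum fun o _ => Finset.sum_le_sum fun b _ => ?_
    split_ifs with h
    · exact μ.mono Set.inter_subset_right
    · have : {x | Good x ∧ ¬ prev x} ∩ (fun x => (Nm T P a x, g x)) ⁻¹' {(o, b)} = ∅ := by
        rw [Set.eq_empty_iff_forall_notMem]
        rintro x ⟨⟨hx1, hx2⟩, hx3⟩
        simp at hx3
        exact h ⟨x, hx3.1, hx3.2, hx1, hx2⟩
      rw [this, μ.empty]
  have e4 := mul_le_mul_of_nonneg_right e3 (sub_nonneg.2 hYZ)
  refine e4.trans ?_
  linarith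

end step
end DC2


namespace DC2

lemma greedy {S X : Type*} [Fintype S] [Nonempty X] (n : ℕ) (hn : Fintype.card S ≤ n)
    (G : S → X → Prop) (R : X → X → Prop) (hR : ∀ x y, R x y → R y x)
    (h : ∀ s, ∀ Z : Finset X, Z.card ≤ n → ∃ y, G s y ∧ ∀ z ∈ Z, R y z) :
    ∃ c : S → X, (∀ s, G s (c s)) ∧ ∀ s s', s ≠ s' → R (c s) (c s') := by
  classical
  have key : ∀ I : Finset S, ∃ c : S → X, (∀ s ∈ I, G s (c s)) ∧
      ∀ s ∈ I, ∀ s' ∈ I, s ≠ s' → R (c s) (c s') := by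
    intro I
    induction I using Finset.induction_on with
    | empty => exact ⟨fun _ => Classical.arbitrary X, by simp, by simp⟩
    | insert b I hb ih =>
      obtain ⟨c, h1, h2⟩ := ih
      obtain ⟨y, hy1, hy2⟩ := h b (I.image c)
        (Finset.card_image_le.trans ((Finset.card_le_univ I).trans hn))
      have hne : ∀ s ∈ I, s ≠ b := by rintro s hs rfl; exact hb hs
      refine ⟨Function.update c b y, ?_, ?_⟩
      · intro s hs
        rcases Finset.mem_insert.1 hs with rfl | hs
        · simpa using hy1
        · rw [Function.update_of_ne (hne s hs)]; exact h1 s hs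
      · intro s hs0 s' hs' hss
        rcases Finset.mem_insert.1 hs0 with rfl | hs
        · rcases Finset.mem_insert.1 hs' with rfl | hs'
          · exact absurd rfl hss
          · rw [Function.update_self, Function.update_of_ne (hne s' hs')]
            exact hy2 _ (Finset.mem_image_of_mem c hs')
        · rcases Finset.mem_insert.1 hs' with rfl | hs'
          · rw [Function.update_self, Function.update_of_ne (hne s hs)]
            exact hR _ _ (hy2 _ (Finset.mem_image_of_mem c hs))
          · rw [Function.update_of_ne (hne s hs), Function.update_of_ne (hne s' hs')]
            exact h2 s hs s' hs' hss
  obtain ⟨c, h1, h2⟩ := key Finset.univ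
  exact ⟨c, fun s => h1 s (Finset.mem_univ s),
    fun s s' => h2 s (Finset.mem_univ s) s' (Finset.mem_univ s')⟩

section tree
variable {X : Type*} (T : X → X) {Λ : Type*} [Fintype Λ] (P : X → Λ)
  {β : ℕ → Type} [∀ k, Fintype (β k)] (Q : ∀ k, X → β k)
  (far : Λ → Λ → Prop) (δ : ℝ) (a : ℕ → ℕ) (Γ : Finset (ℕ × ℕ))

/-- Goodness: the point starts a tree of the given depth. -/
def good : ℕ → ℕ → X → Prop
  | 0, _, _ => True
  | f + 1, k, x => ∀ Z : Finset X, Z.card ≤ 2 ^ (k + 1) →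
      ∃ y, nm T Q (W 0 0 (a k) ∪ Γ) y = nm T Q (W 0 0 (a k) ∪ Γ) x ∧ good f (k + 1) y ∧
        ∀ z ∈ Z, Sep far δ (Nm T P (a (k + 1)) y) (Nm T P (a (k + 1)) z)

lemma good_meas (μ : FAM X) (η : ℕ → ℝ) (K : ℕ)
    (h : ∀ (Good : X → Prop) (k : ℕ), k < K →
      μ.m {x | Good x ∧ ¬ (∀ Z : Finset X, Z.card ≤ 2 ^ (k + 1) →
        ∃ y, nm T Q (W 0 0 (a k) ∪ Γ) y = nm T Q (W 0 0 (a k) ∪ Γ) x ∧ Good y ∧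
        ∀ z ∈ Z, Sep far δ (Nm T P (a (k + 1)) y) (Nm T P (a (k + 1)) z))} ≤ η k)
    (f k : ℕ) (hk : f + k ≤ K) :
    μ.m {x | ¬ good T P Q far δ a Γ f k x} ≤ ∑ i ∈ Finset.range f, η (k + i) := by
  induction f generalizing k with
  | zero => simp [good, μ.empty]
  | succ f ih =>
    have h1 := ih (k + 1) (by omega)
    have h2 := h (good T P Q far δ a Γ f (k + 1)) k (by omega)
    rw [Finset.sum_range_succ']
    have e : ∀ i, k + 1 + i = k + (i + 1) := by intro i; omega
    simp only [e] at h1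
    set A := {x | ¬ good T P Q far δ a Γ f (k + 1) x} with hA
    set B := {x | ¬ good T P Q far δ a Γ (f + 1) k x} with hB
    have h3 : μ.m B ≤ μ.m (A ∪ (B \ A)) := μ.mono (by rw [Set.union_sdiff_self]; simp)
    rw [μ.add A (B \ A) Set.disjoint_sdiff_right] at h3
    have h4 : μ.m (B \ A) ≤ η k := by
      refine le_trans (μ.mono ?_) h2
      rintro x ⟨hx1, hx2⟩
      refine ⟨?_, hx1⟩
      by_contra hc
      exact hx2 hc
    simp only [add_zero]
    linarith

variable {far}

lemma tree
    (hfar : ∀ b c, far b c → far c b)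
    (hQ0 : ∀ x y, Q 0 x = Q 0 y ↔ P x = P y)
    (ha : Monotone a)
    (K : ℕ) (x0 : X) (hx0 : good T P Q far δ a Γ K 0 x0) :
    ∃ y : (ℕ → Bool) → X, ∀ ω, nm T Q Γ (y ω) = nm T Q Γ x0 ∧
      ∀ ω' j, j ≤ K → (∃ i < j, ω i ≠ ω' i) →
        Sep far δ (Nm T P (a j) (y ω)) (Nm T P (a j) (y ω')) := by
  have : Nonempty X := ⟨x0⟩
  suffices H : ∀ k ≤ K, ∃ y : (ℕ → Bool) → X, ∀ ω, good T P Q far δ a Γ (K - k) k (y ω) ∧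
      nm T Q Γ (y ω) = nm T Q Γ x0 ∧
      ∀ ω' j, j ≤ k → (∃ i < j, ω i ≠ ω' i) →
        Sep far δ (Nm T P (a j) (y ω)) (Nm T P (a j) (y ω')) by
    obtain ⟨y, hy⟩ := H K le_rfl
    exact ⟨y, fun ω => (hy ω).2⟩
  intro k
  induction k with
  | zero =>
    intro _
    refine ⟨fun _ => x0, fun ω => ⟨hx0, rfl, ?_⟩⟩
    rintro ω' j hj ⟨i, hi, -⟩
    omega
  | succ k ih =>
    intro hk
    obtain ⟨y, hy⟩ := ih (by omega)
    have eK : K - k = (K - (k + 1)) + 1 := by omega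
    set ext : (Fin (k + 1) → Bool) → ℕ → Bool :=
      fun s i => if h : i < k + 1 then s ⟨i, h⟩ else false with hext
    obtain ⟨c, hc1, hc2⟩ := greedy (S := Fin (k + 1) → Bool) (X := X) (2 ^ (k + 1)) (by simp)
      (fun s y' => nm T Q (W 0 0 (a k) ∪ Γ) y' = nm T Q (W 0 0 (a k) ∪ Γ) (y (ext s)) ∧
        good T P Q far δ a Γ (K - (k + 1)) (k + 1) y')
      (fun y z => Sep far δ (Nm T P (a (k + 1)) y) (Nm T P (a (k + 1)) z))
      (fun _ _ h => h.symm hfar)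
      (by
        intro s Z hZ
        have := (hy (ext s)).1
        rw [eK] at this
        obtain ⟨y', h1, h2, h3⟩ := this Z hZ
        exact ⟨y', ⟨h1, h2⟩, h3⟩)
    refine ⟨fun ω => c (fun i => ω i), fun ω => ⟨(hc1 _).2, ?_, ?_⟩⟩
    · rw [← (hy (ext (fun i => ω i))).2.1]
      have := (hc1 (fun i => ω i)).1
      rw [nm_eq] at this ⊢
      intro t l htl
      exact this t l (Finset.mem_union_right _ htl)
    · rintro ω' j hj ⟨i, hi, hne⟩
      by_cases hjk : j ≤ k
      · have hNm : ∀ s, Nm T P (a j) (c s) = Nm T P (a j) (y (ext s)) := by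
          intro s
          have := (hc1 s).1
          rw [nm_eq] at this
          rw [Nm_eq]
          intro i hi
          rw [← hQ0]
          apply this
          apply Finset.mem_union_left
          rw [mem_W]
          exact ⟨⟨by omega, lt_of_lt_of_le hi (ha hjk)⟩, rfl⟩
        simp only [hNm]
        refine (hy _).2.2 _ j hjk ⟨i, hi, ?_⟩
        simp only [hext]
        rw [dif_pos (by omega), dif_pos (by omega)]
        exact hne
      · have : j = k + 1 := by omega
        subst this
        apply hc2
        intro heq
        exact hne (congrFun heq ⟨i, hi⟩)

end tree

theorem core {X : Type*} [Nonempty X] (T : X → X) {Λ : Type*} [Fintype Λ] (P : X → Λ)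
    {β : ℕ → Type} [∀ k, Fintype (β k)] (Q : ∀ k, X → β k)
    (hQ : ∀ j k x y, j ≤ k → Q k x = Q k y → Q j x = Q j y)
    (hQ0 : ∀ x y, Q 0 x = Q 0 y ↔ P x = P y)
    {w : Λ → ℝ} {far : Λ → Λ → Prop} {L δ : ℝ} (hL : 0 ≤ L) (hw : ∀ l, 0 < w l)
    (hw1 : ∀ l, w l ≤ 1)
    (hone : ∀ l' l₁ l₂, ¬ far l₁ l' → ¬ far l₂ l' → w l₁ ≠ Real.exp (-L) →
      w l₂ ≠ Real.exp (-L) → l₁ = l₂)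
    (hfar : ∀ b c, far b c → far c b)
    (c : ℝ) (hc : 0 < c) (hlim : 4 * c ≤ (subadd T P hw).lim)
    (hLδ : Real.log (1 + Fintype.card Λ * Real.exp (-L)) + L * δ ≤ 2 * c) :
    ∃ a : ℕ → ℕ, (∀ k, (k + 1) * a k ≤ a (k + 1)) ∧ a 0 = 0 ∧ (∀ k, k < a (k + 1)) ∧
      ∀ K, ∃ y : (ℕ → Bool) → X, ∀ ω ω',
        (∀ k ≤ K, ∀ i, a k ≤ i → i < (k + 1) * a k → Q k (T^[i] (y ω)) = Q k (T^[i] (y ω'))) ∧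
        ∀ j, j ≤ K → (∃ i < j, ω i ≠ ω' i) →
          Sep far δ (Nm T P (a j) (y ω)) (Nm T P (a j) (y ω')) := by
  obtain ⟨μ, hinv, heq⟩ := exists_equilibrium T P hw
  set p := (subadd T P hw).lim with hp
  set ε : ℕ → ℝ := fun k => c / 3 * (1 / 2) ^ (k + 1) with hε
  have hε0 : ∀ k, 0 < ε k := fun k => by simp only [hε]; positivity
  have hbd := Zf_bdd T P hw
  have ht := (subadd T P hw).tendsto_lim hbd
  set U : ℕ → ℕ → Prop := fun k a => 0 < a ∧ Real.log (Zf T P w a) ≤ a * (p + ε k) ∧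
    k * Real.log 2 ≤ a * c ∧ Real.log 2 ≤ ε k * a with hU
  have hU1 : ∀ k, ∀ᶠ a in atTop, U k a := by
    intro k
    have e0 : ∀ᶠ a : ℕ in atTop, 0 < a := eventually_gt_atTop 0
    have e1 := ht.eventually (eventually_le_nhds (show p < p + ε k by linarith [hε0 k]))
    have e2 : ∀ᶠ a : ℕ in atTop, k * Real.log 2 / c ≤ a :=
      tendsto_natCast_atTop_atTop.eventually_ge_atTop _
    have e3 : ∀ᶠ a : ℕ in atTop, Real.log 2 / ε k ≤ a :=
      tendsto_natCast_atTop_atTop.eventually_ge_atTop _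
    filter_upwards [e0, e1, e2, e3] with a h0 h1 h2 h3
    have h0' : (0:ℝ) < a := by exact_mod_cast h0
    rw [div_le_iff₀ h0'] at h1
    rw [div_le_iff₀ hc] at h2
    rw [div_le_iff₀ (hε0 k)] at h3
    exact ⟨h0, by linarith, h2, by linarith⟩
  obtain ⟨a, ha1, ha0, ha2, ha3, ha4⟩ := (poly_of T Q μ hinv hQ).main ε hε0 U hU1
  have hamono : Monotone a := by
    apply monotone_nat_of_le_succ
    intro k
    have := ha1 k
    nlinarith
  refine ⟨a, ha1, ha0, ha2, ?_⟩
  intro K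
  set Γ := (Finset.range (K + 1)).biUnion fun j => W j (a j) ((j + 1) * a j) with hΓ
  have hHN : ∀ n, μ.H (nm T Q (W 0 0 n)) = μ.H (Nm T P n) := by
    intro n
    apply μ.H_congr
    intro x y
    rw [Nm_eq, nm_eq]
    constructor
    · intro h t l htl
      rw [mem_W] at htl
      obtain ⟨⟨-, h1⟩, rfl⟩ := htl
      rw [hQ0]; exact h t h1
    · intro h i hi
      rw [← hQ0]
      exact h i 0 (by rw [mem_W]; exact ⟨⟨by omega, hi⟩, rfl⟩)
  have hmeas : ∀ (Good : X → Prop) (k : ℕ), k < K →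
      μ.m {x | Good x ∧ ¬ (∀ Z : Finset X, Z.card ≤ 2 ^ (k + 1) →
        ∃ y, nm T Q (W 0 0 (a k) ∪ Γ) y = nm T Q (W 0 0 (a k) ∪ Γ) x ∧ Good y ∧
        ∀ z ∈ Z, Sep far δ (Nm T P (a (k + 1)) y) (Nm T P (a (k + 1)) z))} ≤
        (1 / 2) ^ (k + 2) := by
    intro Good k hk
    obtain ⟨u0, u1, u2, u3⟩ := ha3 k
    have u0' : (0:ℝ) < a (k + 1) := by exact_mod_cast u0
    have low := ha4 K k hk
    simp only [hHN] at low
    have e : μ.H (fun x => (Nm T P (a (k + 1)) x, nm T Q (W 0 0 (a k) ∪ Γ) x)) =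
        μ.H (nm T Q (W 0 0 (a (k + 1)) ∪ Γ)) := by
      apply μ.H_congr
      intro x y
      simp only [Prod.mk.injEq, Nm_eq, nm_eq, Finset.mem_union]
      constructor
      · intro h
        refine ⟨fun i hi => ?_, ?_⟩
        · rw [← hQ0]
          exact h i 0 (Or.inl (by rw [mem_W]; exact ⟨⟨by omega, hi⟩, rfl⟩))
        · rintro t l (htl | htl)
          · apply h t l
            left
            rw [mem_W] at htl ⊢
            exact ⟨⟨htl.1.1, lt_of_lt_of_le htl.1.2 (hamono (by omega))⟩, htl.2⟩
          · exact h t l (Or.inr htl)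
      · rintro ⟨h1, h2⟩ t l (htl | htl)
        · rw [mem_W] at htl
          obtain ⟨⟨-, h3⟩, rfl⟩ := htl
          rw [hQ0]; exact h1 t h3
        · exact h2 t l (Or.inr htl)
    rw [← e] at low
    set Y : ℝ := ((2 ^ (k + 1) : ℕ) : ℝ) *
      ((1 + Fintype.card Λ * Real.exp (-L)) * Real.exp (L * δ)) ^ (a (k + 1)) with hY
    have hlogY : Real.log Y ≤ 3 * c * a (k + 1) := by
      have h1 : (0:ℝ) < 1 + Fintype.card Λ * Real.exp (-L) := by positivity
      rw [hY, Real.log_mul (by positivity) (by positivity), Real.log_pow,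
        Real.log_mul h1.ne' (by positivity), Real.log_exp]
      push_cast
      rw [Real.log_pow]
      have := mul_le_mul_of_nonneg_left hLδ u0'.le
      push_cast at u2 ⊢
      linarith
    have hlogZ : 4 * c * a (k + 1) ≤ Real.log (Zf T P w (a (k + 1))) := by
      have := (subadd T P hw).lim_le_div hbd u0.ne'
      rw [le_div_iff₀ u0'] at this
      have h2 := mul_le_mul_of_nonneg_right hlim u0'.le
      linarith
    have est := step_est T P μ hinv hL hw hw1 hone (nm T Q (W 0 0 (a k) ∪ Γ)) (a (k + 1))
      (2 ^ (k + 1)) (by positivity) Good p (ε (k + 1)) Y hY (by nlinarith) u1 low (heq _)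
    set mm := μ.m {x | Good x ∧ ¬ (∀ Z : Finset X, Z.card ≤ 2 ^ (k + 1) →
        ∃ y, nm T Q (W 0 0 (a k) ∪ Γ) y = nm T Q (W 0 0 (a k) ∪ Γ) x ∧ Good y ∧
        ∀ z ∈ Z, Sep far δ (Nm T P (a (k + 1)) y) (Nm T P (a (k + 1)) z))} with hmm
    have hmm0 : 0 ≤ mm := μ.nonneg _
    have h1 : mm * (c * a (k + 1)) ≤ 3 * ε (k + 1) * a (k + 1) := by
      have : mm * (c * a (k + 1)) ≤ mm * (Real.log (Zf T P w (a (k + 1))) - Real.log Y) :=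
        mul_le_mul_of_nonneg_left (by linarith) hmm0
      linarith
    have h2 : 3 * ε (k + 1) * a (k + 1) = (1 / 2) ^ (k + 2) * (c * a (k + 1)) := by
      simp only [hε]; ring
    rw [h2] at h1
    exact le_of_mul_le_mul_right h1 (by positivity)
  have hgm := good_meas T P Q far δ a Γ μ (fun k => (1 / 2) ^ (k + 2)) K hmeas K 0 (by omega)
  have hex : ∃ x0, good T P Q far δ a Γ K 0 x0 := by
    by_contra hno
    push Not at hno
    have : {x | ¬ good T P Q far δ a Γ K 0 x} = Set.univ := by
      ext x; simp [hno x]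
    rw [this, μ.univ] at hgm
    have hs : ∀ K : ℕ, ∑ i ∈ Finset.range K, ((1:ℝ) / 2) ^ (0 + i + 2) =
        1 / 2 - (1 / 2) ^ (K + 1) := by
      intro K
      induction K with
      | zero => norm_num
      | succ K ih => rw [Finset.sum_range_succ, ih]; ring
    rw [hs] at hgm
    have : (0:ℝ) < (1 / 2) ^ (K + 1) := by positivity
    linarith
  obtain ⟨x0, hx0⟩ := hex
  obtain ⟨y, hy⟩ := tree T P Q δ a Γ hfar hQ0 hamono K x0 hx0
  refine ⟨y, fun ω ω' => ⟨?_, (hy ω).2 ω'⟩⟩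
  intro k hk i hi1 hi2
  have := (hy ω).1.trans (hy ω').1.symm
  rw [nm_eq] at this
  apply this
  rw [hΓ, Finset.mem_biUnion]
  exact ⟨k, Finset.mem_range.2 (by omega), by rw [mem_W]; exact ⟨⟨hi1, hi2⟩, rfl⟩⟩

end DC2


namespace DC2

lemma ent_growth {X : Type*} [MetricSpace X] (T : X → X)
    (hent : 0 < Dynamics.coverEntropy T (Set.univ : Set X)) :
    ∃ r > 0, ∃ h : ℝ, 0 < h ∧ ∃ᶠ n : ℕ in atTop, ∀ s : Finset X,
      (∀ x, ∃ z ∈ s, ∀ i < n, dist (T^[i] x) (T^[i] z) < r) → Real.exp (h * n) ≤ s.card := by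
  unfold Dynamics.coverEntropy at hent
  rw [lt_iSup_iff] at hent
  obtain ⟨U, hU⟩ := hent
  rw [lt_iSup_iff] at hU
  obtain ⟨hU1, hU2⟩ := hU
  obtain ⟨r, hr, hrU⟩ := Metric.mem_uniformity_dist.1 hU1
  obtain ⟨h, hh1, hh2⟩ := EReal.lt_iff_exists_real_btwn.1 hU2
  refine ⟨r, hr, h, by exact_mod_cast hh1, ?_⟩
  unfold Dynamics.coverEntropyEntourage at hh2
  have := ExpGrowth.frequently_exp_le hh2
  refine this.mono fun n hn s hs => ?_
  have h1 : Dynamics.IsDynCoverOf T Set.univ U n (s : Set X) := by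
    intro x _
    obtain ⟨z, hz, hz2⟩ := hs x
    refine ⟨z, hz, ?_⟩
    exact Dynamics.mem_dynEntourage.2 fun k hk => hrU (hz2 k hk)
  have h2 := h1.coverMincard_le_card
  have h3 : EReal.exp ((h : EReal) * n) ≤ (s.card : ENNReal) := by
    refine hn.trans ?_
    have := ENat.toENNReal_mono h2
    simpa using this
  have h4 : ((h : EReal) * (n : EReal)) = ((h * n : ℝ) : EReal) := by
    push_cast; rfl
  rw [h4, EReal.exp_coe] at h3
  have h5 := ENNReal.ofReal_le_iff_le_toReal (by simp) |>.1 h3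
  simpa using h5

lemma exists_first {m : ℕ} (p : Fin m → Prop) (h : ∃ j, p j) :
    ∃ j, p j ∧ ∀ j' < j, ¬ p j' := by
  classical
  obtain ⟨j, hj⟩ := h
  have hne : (Finset.univ.filter p).Nonempty := ⟨j, by simp [hj]⟩
  refine ⟨(Finset.univ.filter p).min' hne, ?_, ?_⟩
  · have := Finset.min'_mem _ hne
    exact (Finset.mem_filter.1 this).2
  · intro j' hj' hp
    exact absurd (Finset.min'_le _ j' (by simp [hp])) (not_le.2 hj')

lemma exists_centers (X : Type*) [MetricSpace X] [CompactSpace X] {r : ℝ} (hr : 0 < r) :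
    ∃ (m : ℕ) (c : Fin m → X), ∀ x, ∃ j, dist x (c j) < r := by
  obtain ⟨t, -, hfin, ht⟩ := finite_cover_balls_of_compact (isCompact_univ (X := X)) hr
  have := hfin.fintype
  refine ⟨Fintype.card t, fun j => ((Fintype.equivFin t).symm j : X), fun x => ?_⟩
  have := ht (Set.mem_univ x)
  simp only [Set.mem_iUnion, Metric.mem_ball, exists_prop] at this
  obtain ⟨y, hy, hxy⟩ := this
  exact ⟨Fintype.equivFin t ⟨y, hy⟩, by simpa using hxy⟩

lemma geo (X : Type*) [MetricSpace X] [CompactSpace X] {r : ℝ} (hr : 0 < r) :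
    ∃ m : ℕ, ∀ K : ℕ, 0 < K → ∃ t₀ > 0, ∃ (J : Fin K → X → Fin m) (B : Fin K → X → Bool),
      (∀ l x y, J l x = J l y → dist x y < r) ∧
      (∀ l x y, J l x ≠ J l y → (B l x = false ∨ B l y = false) → t₀ ≤ dist x y) ∧
      ∀ x, (Finset.univ.filter fun l => B l x = true).card ≤ m := by
  classical
  obtain ⟨m, c, hc⟩ := exists_centers X (r := r / 4) (by positivity)
  refine ⟨m, fun K hK => ?_⟩
  have hK' : (0:ℝ) < K := by exact_mod_cast hK
  set t₀ : ℝ := r / (8 * K) with ht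
  have ht0 : 0 < t₀ := by positivity
  set ρ : Fin K → ℝ := fun l => r / 4 + 2 * t₀ * (l : ℕ) with hρ
  have hρ1 : ∀ l, r / 4 ≤ ρ l := by intro l; simp only [hρ]; have : (0:ℝ) ≤ (l:ℕ) := by positivity
                                    nlinarith
  have hρ2 : ∀ l, ρ l ≤ r / 2 := by
    intro l; simp only [hρ]
    have : ((l:ℕ) : ℝ) ≤ K := by exact_mod_cast l.2.le
    have h2 : 2 * t₀ * K = r / 4 := by rw [ht]; field_simp; ring
    nlinarith
  have hfirst : ∀ l x, ∃ j, dist x (c j) < ρ l ∧ ∀ j' < j, ¬ dist x (c j') < ρ l := by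
    intro l x
    apply exists_first
    obtain ⟨j, hj⟩ := hc x
    exact ⟨j, hj.trans_le (hρ1 l)⟩
  choose J hJ1 hJ2 using hfirst
  refine ⟨t₀, ht0, J, fun l x => decide (∃ j, |dist x (c j) - ρ l| < t₀), ?_, ?_, ?_⟩
  · intro l x y h
    have h1 := hJ1 l x
    have h2 := hJ1 l y
    rw [h] at h1
    have := dist_triangle_right x y (c (J l y))
    linarith [hρ2 l]
  · have key : ∀ l x y, J l x < J l y →
        ((¬ ∃ j, |dist x (c j) - ρ l| < t₀) ∨ ¬ ∃ j, |dist y (c j) - ρ l| < t₀) →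
        t₀ ≤ dist x y := by
      intro l x y hlt h
      have h1 := hJ1 l x
      have h2 := hJ2 l y _ hlt
      rw [not_lt] at h2
      have h3 := dist_triangle_left y (c (J l x)) x
      rcases h with h | h
      · push Not at h
        have h4 := h (J l x)
        rw [abs_of_neg (by linarith)] at h4
        linarith
      · push Not at h
        have h4 := h (J l x)
        rw [abs_of_nonneg (by linarith)] at h4
        linarith
    intro l x y hne h
    simp only [decide_eq_false_iff_not] at h
    rcases lt_or_gt_of_ne hne with hlt | hlt
    · exact key l x y hlt h
    · rw [dist_comm]; exact key l y x hlt h.symm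
  · intro x
    simp only [decide_eq_true_eq]
    have : (Finset.univ.filter fun l => ∃ j, |dist x (c j) - ρ l| < t₀) ⊆
        Finset.univ.biUnion fun j => Finset.univ.filter fun l => |dist x (c j) - ρ l| < t₀ := by
      intro l
      simp
    refine (Finset.card_le_card this).trans ?_
    refine (Finset.card_biUnion_le_card_mul _ _ 1 ?_).trans (by simp)
    intro j _
    rw [Finset.card_le_one]
    simp only [Finset.mem_filter, Finset.mem_univ, true_and]
    have key : ∀ l l' : Fin K, l < l' → |dist x (c j) - ρ l| < t₀ → |dist x (c j) - ρ l'| < t₀ →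
        False := by
      intro l l' hll h1 h2
      rw [abs_lt] at h1 h2
      have h3 : ((l:ℕ):ℝ) + 1 ≤ (l':ℕ) := by exact_mod_cast hll
      simp only [hρ] at h1 h2
      nlinarith
    intro l h1 l' h2
    rcases lt_trichotomy l l' with h | h | h
    · exact (key l l' h h1 h2).elim
    · exact h
    · exact (key l' l h h2 h1).elim

/-- The weight. -/
noncomputable def wt (L : ℝ) {m : ℕ} (p : Fin m × Bool) : ℝ :=
  if p.2 then Real.exp (-L) else 1

lemma wt_pos (L : ℝ) {m : ℕ} (p : Fin m × Bool) : 0 < wt L p := by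
  unfold wt; split_ifs <;> positivity

lemma press_low {X : Type*} [MetricSpace X] [Nonempty X] (T : X → X) {r h : ℝ} (hh : 0 < h)
    (hf : ∃ᶠ n : ℕ in atTop, ∀ s : Finset X,
      (∀ x, ∃ z ∈ s, ∀ i < n, dist (T^[i] x) (T^[i] z) < r) → Real.exp (h * n) ≤ s.card)
    {m K : ℕ} (hK : 0 < K) (J : Fin K → X → Fin m) (B : Fin K → X → Bool)
    (hJ : ∀ l x y, J l x = J l y → dist x y < r)
    (hB : ∀ x, (Finset.univ.filter fun l => B l x = true).card ≤ m)
    (L : ℝ) (hL : 0 ≤ L) (hLK : L * m / K ≤ h / 4) :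
    ∃ l, h / 2 ≤ (subadd T (fun x => (J l x, B l x)) (wt_pos L)).lim := by
  classical
  have hK' : (0:ℝ) < K := by exact_mod_cast hK
  set PP : Fin K → X → Fin m × Bool := fun l x => (J l x, B l x) with hPP
  -- the number of bad visits of a name
  set vis : ∀ n, (Fin n → Fin m × Bool) → ℕ := fun n u =>
    (Finset.univ.filter fun i => (u i).2 = true).card with hvis
  have hvisx : ∀ n x, ∃ l, vis n (Nm T (PP l) n x) * K ≤ m * n := by
    intro n x
    by_contra hno
    push Not at hno
    have h1 : ∑ l : Fin K, vis n (Nm T (PP l) n x) ≤ m * n := by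
      have e : ∀ l, vis n (Nm T (PP l) n x) =
          ∑ i : Fin n, if B l (T^[i] x) = true then 1 else 0 := by
        intro l
        simp only [hvis, Finset.card_filter, Nm, hPP]
        refine Finset.sum_congr rfl fun i _ => ?_
        congr
      simp only [e]
      rw [Finset.sum_comm]
      have h2 : ∀ i : Fin n, (∑ l, if B l (T^[i] x) = true then 1 else 0) ≤ m := by
        intro i
        rw [← Finset.card_filter]
        exact hB _
      refine (Finset.sum_le_sum fun i _ => h2 i).trans ?_
      simp [mul_comm]
    have : Nonempty (Fin K) := ⟨⟨0, hK⟩⟩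
    have h3 : ∑ l : Fin K, m * n < ∑ l : Fin K, vis n (Nm T (PP l) n x) * K :=
      Finset.sum_lt_sum_of_nonempty Finset.univ_nonempty fun l _ => hno l
    have h5 : ∑ l : Fin K, vis n (Nm T (PP l) n x) * K = (∑ l : Fin K, vis n (Nm T (PP l) n x)) * K :=
      (Finset.sum_mul _ _ _).symm
    rw [h5] at h3
    simp only [Finset.sum_const, Finset.card_univ, Fintype.card_fin, smul_eq_mul] at h3
    have h4 := Nat.mul_le_mul_right K h1
    rw [mul_comm K] at h3
    omega
  have hmain : ∃ᶠ n : ℕ in atTop, ∃ l,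
      Real.exp (h * n) ≤ K * (Zf T (PP l) (wt L) n * Real.exp (h / 4 * n)) := by
    refine hf.mono fun n hn => ?_
    set good : Fin K → Finset (Fin n → Fin m × Bool) := fun l =>
      Finset.univ.filter fun u => (∃ x, Nm T (PP l) n x = u) ∧ vis n u * K ≤ m * n with hgood
    set rep : Fin K → (Fin n → Fin m × Bool) → X := fun l u =>
      if hx : ∃ x, Nm T (PP l) n x = u then hx.choose else Classical.arbitrary X with hrep
    have hrep1 : ∀ l x, Nm T (PP l) n (rep l (Nm T (PP l) n x)) = Nm T (PP l) n x := by
      intro l x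
      have hx : ∃ x', Nm T (PP l) n x' = Nm T (PP l) n x := ⟨x, rfl⟩
      simp only [hrep, dif_pos hx]
      exact hx.choose_spec
    set s : Finset X := Finset.univ.biUnion fun l => (good l).image (rep l) with hs
    have h1 := hn s (by
      intro x
      obtain ⟨l, hl⟩ := hvisx n x
      refine ⟨rep l (Nm T (PP l) n x), ?_, ?_⟩
      · rw [hs, Finset.mem_biUnion]
        refine ⟨l, Finset.mem_univ l, Finset.mem_image_of_mem _ ?_⟩
        rw [hgood]
        simp only [Finset.mem_filter, Finset.mem_univ, true_and]
        exact ⟨⟨x, rfl⟩, hl⟩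
      · intro i hi
        have := hrep1 l x
        rw [Nm_eq] at this
        have h2 := this i hi
        apply hJ l
        exact (congrArg Prod.fst h2).symm)
    have h2 : (s.card : ℝ) ≤ ∑ l : Fin K, ((good l).card : ℝ) := by
      rw [hs]
      have : (Finset.univ.biUnion fun l => (good l).image (rep l)).card ≤
          ∑ l : Fin K, (good l).card :=
        Finset.card_biUnion_le.trans (Finset.sum_le_sum fun l _ => Finset.card_image_le)
      exact_mod_cast this
    have h3 : ∀ l, ((good l).card : ℝ) ≤ Zf T (PP l) (wt L) n * Real.exp (h / 4 * n) := by
      intro l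
      rw [Zf, Finset.sum_mul]
      have hnn : ∀ u, 0 ≤ ind T (PP l) n u * (∏ i, wt L (u i)) * Real.exp (h / 4 * n) := by
        intro u
        have := ind_nonneg T (PP l) n u
        have : 0 ≤ ∏ i, wt L (u i) := Finset.prod_nonneg fun i _ => (wt_pos L _).le
        positivity
      have e1 : ((good l).card : ℝ) = ∑ u ∈ good l, (1:ℝ) := by simp
      rw [e1]
      refine le_trans (Finset.sum_le_sum (g := fun u =>
        ind T (PP l) n u * (∏ i, wt L (u i)) * Real.exp (h / 4 * n)) ?_)
        (Finset.sum_le_sum_of_subset_of_nonneg (Finset.subset_univ _) fun u _ _ => hnn u)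
      intro u hu
      obtain ⟨hu1, hu2⟩ := (Finset.mem_filter.1 hu).2
      have hi1 : ind T (PP l) n u = 1 := if_pos hu1
      have hp : ∏ i, wt L (u i) = Real.exp (-(L * vis n u)) := by
        simp only [wt]
        rw [Finset.prod_ite]
        simp only [Finset.prod_const, one_pow, mul_one]
        rw [← Real.exp_nat_mul]
        congr 1
        simp only [hvis]; ring
      rw [hi1, hp, one_mul, ← Real.exp_add]
      apply Real.one_le_exp
      have hv : (vis n u : ℝ) * K ≤ m * n := by exact_mod_cast hu2
      have hv2 : (vis n u : ℝ) ≤ m * n / K := by rwa [le_div_iff₀ hK']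
      have hv3 := mul_le_mul_of_nonneg_left hv2 hL
      have hv4 : L * (m * n / K) ≤ h / 4 * n := by
        have := mul_le_mul_of_nonneg_right hLK (Nat.cast_nonneg (α := ℝ) n)
        calc L * (m * n / K) = L * m / K * n := by ring
          _ ≤ _ := this
      linarith
    by_contra hno
    push Not at hno
    have : Nonempty (Fin K) := ⟨⟨0, hK⟩⟩
    have h4 : ∑ l : Fin K, K * (Zf T (PP l) (wt L) n * Real.exp (h / 4 * n)) <
        ∑ l : Fin K, Real.exp (h * n) :=
      Finset.sum_lt_sum_of_nonempty Finset.univ_nonempty fun l _ => hno l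
    rw [← Finset.mul_sum] at h4
    simp only [Finset.sum_const, Finset.card_univ, Fintype.card_fin, nsmul_eq_mul] at h4
    have h5 := lt_of_mul_lt_mul_left h4 hK'.le
    have h6 := Finset.sum_le_sum fun l (_ : l ∈ Finset.univ) => h3 l
    linarith
  have hex : ∃ l, ∃ᶠ n : ℕ in atTop,
      Real.exp (h * n) ≤ K * (Zf T (PP l) (wt L) n * Real.exp (h / 4 * n)) := by
    by_contra hno
    push Not at hno
    apply hmain
    have : ∀ l, ∀ᶠ n : ℕ in atTop,
        ¬ Real.exp (h * n) ≤ K * (Zf T (PP l) (wt L) n * Real.exp (h / 4 * n)) := by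
      intro l
      have := hno l
      simpa using this
    filter_upwards [eventually_all.2 this] with n hn
    push Not at hn ⊢
    exact hn
  obtain ⟨l, hl⟩ := hex
  refine ⟨l, ?_⟩
  have ht := (subadd T (PP l) (wt_pos L)).tendsto_lim (Zf_bdd T (PP l) (wt_pos L))
  have hev : ∀ᶠ n : ℕ in atTop, Real.log K / (h / 4) ≤ n :=
    tendsto_natCast_atTop_atTop.eventually_ge_atTop _
  have hfr := hl.and_eventually (hev.and (eventually_gt_atTop 0))
  by_contra hlt
  rw [not_le] at hlt
  have hev2 := ht.eventually (eventually_lt_nhds hlt)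
  obtain ⟨n, ⟨h1, h2, h3⟩, h4⟩ := (hfr.and_eventually hev2).exists
  have hn0 : (0:ℝ) < n := by exact_mod_cast h3
  have hZ := Zf_pos T (PP l) (wt_pos L) n
  have h5 := Real.log_le_log (Real.exp_pos _) h1
  rw [Real.log_exp, Real.log_mul hK'.ne' (by positivity), Real.log_mul hZ.ne' (by positivity),
    Real.log_exp] at h5
  rw [div_le_iff₀ (by positivity)] at h2
  rw [div_lt_iff₀ hn0] at h4
  linarith

lemma setup {X : Type*} [MetricSpace X] [CompactSpace X] [Nonempty X] (T : X → X)
    (hent : 0 < Dynamics.coverEntropy T (Set.univ : Set X)) :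
    ∃ t₀ > 0, ∃ δ > 0, ∃ c > 0, ∃ L ≥ 0, ∃ (m : ℕ) (P : X → Fin m × Bool),
      (∀ x y, (P x).1 ≠ (P y).1 → ((P x).2 = false ∨ (P y).2 = false) → t₀ ≤ dist x y) ∧
      4 * c ≤ (subadd T P (wt_pos L)).lim ∧
      Real.log (1 + Fintype.card (Fin m × Bool) * Real.exp (-L)) + L * δ ≤ 2 * c := by
  obtain ⟨r, hr, h, hh, hf⟩ := ent_growth T hent
  obtain ⟨m, hm⟩ := geo X hr
  set M : ℝ := (Fintype.card (Fin m × Bool) : ℝ) with hM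
  have hM0 : 0 ≤ M := by positivity
  obtain ⟨L, hL1, hL2⟩ : ∃ L : ℝ, 0 < L ∧ M * Real.exp (-L) ≤ h / 8 := by
    have ht : Tendsto (fun L : ℝ => M * Real.exp (-L)) atTop (nhds (M * 0)) :=
      (Real.tendsto_exp_neg_atTop_nhds_zero).const_mul M
    rw [mul_zero] at ht
    have e1 := ht.eventually (eventually_le_nhds (show (0:ℝ) < h / 8 by positivity))
    obtain ⟨L, h1, h2⟩ := (e1.and (eventually_gt_atTop 0)).exists
    exact ⟨L, h2, h1⟩
  obtain ⟨K, hK⟩ := exists_nat_gt (L * m / (h / 4))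
  have hK0 : (0:ℝ) < K := lt_of_le_of_lt (by positivity) hK
  have hKn : 0 < K := by exact_mod_cast hK0
  obtain ⟨t₀, ht₀, J, B, hJ, hfar, hB⟩ := hm K hKn
  obtain ⟨l, hl⟩ := press_low T hh hf hKn J B hJ hB L hL1.le (by
    rw [div_lt_iff₀ (by positivity)] at hK
    rw [div_le_iff₀ hK0]; linarith)
  refine ⟨t₀, ht₀, h / (8 * L), by positivity, h / 8, by positivity, L, hL1.le, m,
    fun x => (J l x, B l x), fun x y => hfar l x y, by linarith, ?_⟩
  have h1 : Real.log (1 + M * Real.exp (-L)) ≤ M * Real.exp (-L) := by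
    have := Real.log_le_sub_one_of_pos (x := 1 + M * Real.exp (-L)) (by positivity)
    linarith
  have h2 : L * (h / (8 * L)) = h / 8 := by field_simp
  linarith

end DC2

namespace DC2

lemma refine_Q {X : Type*} [MetricSpace X] [CompactSpace X] {m : ℕ} (P : X → Fin m × Bool) :
    ∃ (β : ℕ → Type) (_ : ∀ k, Fintype (β k)) (Q : ∀ k, X → β k),
      (∀ j k x y, j ≤ k → Q k x = Q k y → Q j x = Q j y) ∧
      (∀ x y, Q 0 x = Q 0 y ↔ P x = P y) ∧
      ∀ k x y, Q (k + 1) x = Q (k + 1) y → dist x y ≤ 1 / (k + 1 : ℝ) := by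
  have h1 : ∀ k : ℕ, ∃ (n : ℕ) (R : X → Fin n), ∀ x y, R x = R y →
      dist x y ≤ 1 / (k + 1 : ℝ) := by
    intro k
    obtain ⟨n, c, hc⟩ := exists_centers X (r := 1 / (2 * (k + 1 : ℝ))) (by positivity)
    choose R hR using hc
    refine ⟨n, R, fun x y h => ?_⟩
    have e1 := hR x
    have e2 := hR y
    rw [h] at e1
    have := dist_triangle_right x y (c (R y))
    have e3 : 1 / (2 * (k + 1 : ℝ)) + 1 / (2 * (k + 1 : ℝ)) = 1 / (k + 1 : ℝ) := by
      field_simp; norm_num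
    linarith
  choose n R hR using h1
  refine ⟨fun k => (Fin m × Bool) × (∀ i : Fin k, Fin (n i)), fun k => inferInstance,
    fun k x => (P x, fun i => R i x), ?_, ?_, ?_⟩
  · intro j k x y hjk h
    simp only [Prod.mk.injEq] at h ⊢
    refine ⟨h.1, ?_⟩
    funext i
    exact congrFun h.2 ⟨i, lt_of_lt_of_le i.2 hjk⟩
  · intro x y
    simp only [Prod.mk.injEq]
    exact ⟨fun h => h.1, fun h => ⟨h, funext fun i => i.elim0⟩⟩
  · intro k x y h
    simp only [Prod.mk.injEq] at h
    exact hR k x y (congrFun h.2 ⟨k, Nat.lt_succ_self k⟩)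

lemma isClosed_sep {Y : Type*} [TopologicalSpace Y] (F : ℕ → Y → ℝ) (hF : ∀ i, Continuous (F i))
    (n : ℕ) (t b : ℝ) :
    IsClosed {x | b ≤ (((Finset.range n).filter fun i => t ≤ F i x).card : ℝ)} := by
  have : {x | b ≤ (((Finset.range n).filter fun i => t ≤ F i x).card : ℝ)} =
      ⋃ I ∈ ((Finset.range n).powerset.filter fun I => b ≤ (I.card : ℝ)),
        ⋂ i ∈ I, {x | t ≤ F i x} := by
    ext x
    simp only [Set.mem_setOf_eq, Set.mem_iUnion, Finset.mem_filter, Finset.mem_powerset,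
      Set.mem_iInter, exists_prop]
    constructor
    · intro h
      exact ⟨_, ⟨Finset.filter_subset _ _, h⟩, fun i hi => (Finset.mem_filter.1 hi).2⟩
    · rintro ⟨I, ⟨hI1, hI2⟩, hI3⟩
      refine hI2.trans ?_
      norm_cast
      apply Finset.card_le_card
      intro i hi
      exact Finset.mem_filter.2 ⟨hI1 hi, hI3 i hi⟩
  rw [this]
  apply Set.Finite.isClosed_biUnion (Finset.finite_toSet _)
  intro I _
  apply isClosed_biInter
  intro i _
  exact isClosed_le continuous_const (hF i)

lemma limit_exists {X : Type*} [MetricSpace X] [CompactSpace X] [Nonempty X] (T : X → X)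
    (hT : Continuous T) (hent : 0 < Dynamics.coverEntropy T (Set.univ : Set X)) :
    ∃ t₀ > 0, ∃ δ > 0, ∃ a : ℕ → ℕ, (∀ k, k < a (k + 1)) ∧
      ∃ y : (ℕ → Bool) → X, ∀ ω ω',
        (∀ k, ∀ i, a (k + 1) ≤ i → i < (k + 2) * a (k + 1) →
          dist (T^[i] (y ω)) (T^[i] (y ω')) ≤ 1 / (k + 1 : ℝ)) ∧
        ∀ j, (∃ i < j, ω i ≠ ω' i) → δ * a j ≤
          (((Finset.range (a j)).filter fun i =>
            t₀ ≤ dist (T^[i] (y ω)) (T^[i] (y ω'))).card : ℝ) := by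
  classical
  obtain ⟨t₀, ht₀, δ, hδ, c, hc, L, hL, m, P, hP, hlim, hLδ⟩ := setup T hent
  obtain ⟨β, _, Q, hQ, hQ0, hQd⟩ := refine_Q P
  obtain ⟨a, -, -, ha2, hy⟩ := core T P Q hQ hQ0
    (far := fun p q => p.1 ≠ q.1 ∧ (p.2 = false ∨ q.2 = false)) hL (wt_pos L)
    (by
      intro l; unfold wt; split_ifs
      · rw [Real.exp_le_one_iff]; linarith
      · exact le_rfl)
    (by
      intro l' l₁ l₂ h1 h2 h3 h4
      have g : ∀ l : Fin m × Bool, wt L l ≠ Real.exp (-L) → l.2 = false := by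
        intro l hl
        by_contra hne
        apply hl
        unfold wt
        rw [if_pos (by simpa using hne)]
      have g1 := g _ h3
      have g2 := g _ h4
      simp only [g1, g2, true_or, and_true, ne_eq, not_not] at h1 h2
      ext1
      · rw [h1, h2]
      · rw [g1, g2])
    (fun b c h => ⟨h.1.symm, h.2.symm⟩) c hc hlim hLδ
  refine ⟨t₀, ht₀, δ, hδ, a, ha2, ?_⟩
  set S : ℕ → Set ((ℕ → Bool) → X) := fun K => {y | ∀ ω ω',
        (∀ k, k < K → ∀ i, a (k + 1) ≤ i → i < (k + 2) * a (k + 1) →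
          dist (T^[i] (y ω)) (T^[i] (y ω')) ≤ 1 / (k + 1 : ℝ)) ∧
        ∀ j, j ≤ K → (∃ i < j, ω i ≠ ω' i) → δ * a j ≤
          (((Finset.range (a j)).filter fun i =>
            t₀ ≤ dist (T^[i] (y ω)) (T^[i] (y ω'))).card : ℝ)} with hS
  have hcont : ∀ ω ω' i, Continuous fun y : (ℕ → Bool) → X =>
      dist (T^[i] (y ω)) (T^[i] (y ω')) := by
    intro ω ω' i
    exact ((hT.iterate i).comp (continuous_apply ω)).dist
      ((hT.iterate i).comp (continuous_apply ω'))
  have hclosed : ∀ K, IsClosed (S K) := by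
    intro K
    simp only [hS, Set.setOf_forall, Set.setOf_and]
    refine isClosed_iInter fun ω => isClosed_iInter fun ω' => IsClosed.inter ?_ ?_
    · refine isClosed_iInter fun k => isClosed_iInter fun _ => isClosed_iInter fun i =>
        isClosed_iInter fun _ => isClosed_iInter fun _ => ?_
      exact isClosed_le (hcont ω ω' i) continuous_const
    · refine isClosed_iInter fun j => isClosed_iInter fun _ => isClosed_iInter fun _ => ?_
      exact isClosed_sep (fun i (y : (ℕ → Bool) → X) => dist (T^[i] (y ω)) (T^[i] (y ω')))
        (hcont ω ω') _ _ _
  have hne : ∀ K, (S K).Nonempty := by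
    intro K
    obtain ⟨y, hy⟩ := hy K
    refine ⟨y, fun ω ω' => ⟨?_, ?_⟩⟩
    · intro k hk i hi1 hi2
      exact hQd k _ _ ((hy ω ω').1 (k + 1) (by omega) i hi1 hi2)
    · intro j hj hne
      have := (hy ω ω').2 j hj hne
      refine le_trans this ?_
      norm_cast
      apply Finset.card_le_card_of_injOn (fun i : Fin (a j) => (i : ℕ))
      · intro i hi
        have h1 := (Finset.mem_filter.1 hi).2
        simp only [Finset.coe_filter, Finset.mem_range, Set.mem_setOf_eq]
        exact ⟨i.2, hP _ _ h1.1 h1.2⟩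
      · intro i _ i' _ h
        exact Fin.ext h
  have hmono : ∀ K, S (K + 1) ⊆ S K := by
    intro K y hy ω ω'
    exact ⟨fun k hk => (hy ω ω').1 k (by omega), fun j hj => (hy ω ω').2 j (by omega)⟩
  obtain ⟨y, hy⟩ := IsCompact.nonempty_iInter_of_sequence_nonempty_isCompact_isClosed S hmono hne
    (hclosed 0).isCompact hclosed
  rw [Set.mem_iInter] at hy
  refine ⟨y, fun ω ω' => ⟨fun k => (hy (k + 1) ω ω').1 k (by omega),
    fun j => (hy j ω ω').2 j le_rfl⟩⟩

lemma ctf_nonneg {X : Type*} [MetricSpace X] (T : X → X) (x y : X) (t : ℝ) (n : ℕ) :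
    0 ≤ closeTimesFraction T x y t n := by unfold closeTimesFraction; positivity

lemma ctf_le_one {X : Type*} [MetricSpace X] (T : X → X) (x y : X) (t : ℝ) (n : ℕ) :
    closeTimesFraction T x y t n ≤ 1 := by
  unfold closeTimesFraction
  apply div_le_one_of_le₀ _ (Nat.cast_nonneg n)
  have := Finset.card_filter_le (Finset.range n) (fun i => dist (T^[i] x) (T^[i] y) < t)
  rw [Finset.card_range] at this
  exact_mod_cast this

end DC2

theorem positive_entropy_implies_uniform_DC2 {X : Type*} [MetricSpace X] [CompactSpace X]
    (T : X → X) (hT : Continuous T)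
    (hent : 0 < Dynamics.coverEntropy T (Set.univ : Set X)) :
    ∃ t₀ : ℝ, 0 < t₀ ∧ ∃ δ : ℝ, 0 < δ ∧ ∃ E : Set X, ¬ E.Countable ∧
      ∀ x ∈ E, ∀ y ∈ E, x ≠ y →
        (∀ t : ℝ, 0 < t →
          Filter.limsup (fun n : ℕ => closeTimesFraction T x y t n) Filter.atTop = 1) ∧
        Filter.liminf (fun n : ℕ => closeTimesFraction T x y t₀ n) Filter.atTop ≤ 1 - δ := by
  classical
  have hX : Nonempty X := by
    by_contra h
    rw [not_nonempty_iff] at h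
    have h1 : (Set.univ : Set X) = ∅ := Set.eq_empty_of_isEmpty _
    rw [h1, Dynamics.coverEntropy_empty] at hent
    exact absurd hent (by simp)
  obtain ⟨t₀, ht₀, δ, hδ, a, ha, y, hy⟩ := DC2.limit_exists T hT hent
  have hapos : ∀ j, 0 < j → 0 < a j := by
    intro j hj
    obtain ⟨k, rfl⟩ : ∃ k, j = k + 1 := ⟨j - 1, by omega⟩
    have := ha k; omega
  have hinj : Function.Injective y := by
    intro ω ω' h
    by_contra hne
    obtain ⟨i, hi⟩ := Function.ne_iff.1 hne
    have h1 := (hy ω ω').2 (i + 1) ⟨i, by omega, hi⟩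
    rw [h] at h1
    simp only [dist_self, not_le.2 ht₀, Finset.filter_false, Finset.card_empty,
      Nat.cast_zero] at h1
    have h2 : (0:ℝ) < a (i + 1) := by exact_mod_cast hapos _ (by omega)
    have := mul_pos hδ h2
    linarith
  have hbdd1 : ∀ x z t, IsBoundedUnder (· ≤ ·) atTop fun n => closeTimesFraction T x z t n :=
    fun x z t => isBoundedUnder_of ⟨1, DC2.ctf_le_one T x z t⟩
  have hbdd2 : ∀ x z t, IsBoundedUnder (· ≥ ·) atTop fun n => closeTimesFraction T x z t n :=
    fun x z t => isBoundedUnder_of ⟨0, DC2.ctf_nonneg T x z t⟩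
  refine ⟨t₀, ht₀, δ, hδ, Set.range y, ?_, ?_⟩
  · intro hcount
    have := hcount.to_subtype
    have hc : Countable (ℕ → Bool) :=
      (show Function.Injective (fun ω => (⟨y ω, ω, rfl⟩ : Set.range y)) from
        fun _ _ h => hinj (congrArg Subtype.val h)).countable
    obtain ⟨f, hf⟩ := exists_surjective_nat (ℕ → Bool)
    obtain ⟨n, hn⟩ := hf fun n => !(f n n)
    have := congrFun hn n
    cases h : f n n <;> simp [h] at this
  rintro _ ⟨ω, rfl⟩ _ ⟨ω', rfl⟩ hne
  have hωne : ω ≠ ω' := fun h => hne (by rw [h])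
  obtain ⟨i₀, hi₀⟩ := Function.ne_iff.1 hωne
  constructor
  · intro t ht
    apply le_antisymm
    · exact limsup_le_of_le (hbdd2 _ _ _).isCoboundedUnder_le
        (Eventually.of_forall fun n => DC2.ctf_le_one T _ _ t n)
    · have key : ∀ k : ℕ, 1 / (k + 1 : ℝ) < t →
          1 - 1 / (k + 1 : ℝ) ≤ closeTimesFraction T (y ω) (y ω') t ((k + 2) * a (k + 1)) := by
        intro k hk
        have hap : (0:ℝ) < a (k + 1) := by exact_mod_cast hapos (k + 1) (by omega)
        unfold closeTimesFraction
        rw [le_div_iff₀ (by push_cast; positivity)]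
        have h1 : Finset.Ico (a (k + 1)) ((k + 2) * a (k + 1)) ⊆
            (Finset.range ((k + 2) * a (k + 1))).filter
              fun i => dist (T^[i] (y ω)) (T^[i] (y ω')) < t := by
          intro i hi
          rw [Finset.mem_Ico] at hi
          rw [Finset.mem_filter, Finset.mem_range]
          exact ⟨hi.2, lt_of_le_of_lt ((hy ω ω').1 k i hi.1 hi.2) hk⟩
        have h2 := Finset.card_le_card h1
        rw [Nat.card_Ico] at h2
        have h3 : (k + 1) * a (k + 1) ≤ ((Finset.range ((k + 2) * a (k + 1))).filter
              fun i => dist (T^[i] (y ω)) (T^[i] (y ω')) < t).card := by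
          refine le_trans (le_of_eq ?_) h2
          have : (k + 2) * a (k + 1) = (k + 1) * a (k + 1) + a (k + 1) := by ring
          omega
        have h4 : ((k + 1 : ℝ)) * a (k + 1) ≤ (((Finset.range ((k + 2) * a (k + 1))).filter
              fun i => dist (T^[i] (y ω)) (T^[i] (y ω')) < t).card : ℝ) := by exact_mod_cast h3
        refine le_trans ?_ h4
        push_cast
        rw [← mul_assoc]
        apply mul_le_mul_of_nonneg_right _ hap.le
        have h5 : (0:ℝ) < k + 1 := by positivity
        have h6 : (1 - 1 / (k + 1 : ℝ)) * (k + 2) = (k:ℝ) * (k + 2) / (k + 1) := by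
          field_simp; ring
        rw [h6, div_le_iff₀ h5]
        nlinarith
      apply le_of_forall_lt
      intro b hb
      obtain ⟨b', hb1, hb2⟩ := exists_between hb
      refine lt_of_lt_of_le hb1 ?_
      apply le_limsup_of_frequently_le _ (hbdd1 _ _ _)
      rw [frequently_atTop]
      intro N
      have ht0 : Tendsto (fun k : ℕ => 1 / (k + 1 : ℝ)) atTop (nhds 0) :=
        tendsto_one_div_add_atTop_nhds_zero_nat
      have e1 := ht0.eventually (eventually_lt_nhds ht)
      have e2 := ht0.eventually (eventually_lt_nhds (show (0:ℝ) < 1 - b' by linarith))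
      obtain ⟨k, h1, h2, h3⟩ := (e1.and (e2.and (eventually_ge_atTop N))).exists
      refine ⟨(k + 2) * a (k + 1), ?_, ?_⟩
      · have := ha k
        show N ≤ _
        nlinarith
      · have := key k h1
        linarith
  · apply liminf_le_of_frequently_le _ (hbdd2 _ _ _)
    rw [frequently_atTop]
    intro N
    set j := N + i₀ + 1 with hj
    refine ⟨a j, ?_, ?_⟩
    · have h0 : N + i₀ < a j := ha (N + i₀)
      show N ≤ a j
      omega
    · have hap : (0:ℝ) < a j := by exact_mod_cast hapos j (by omega)
      have h1 := (hy ω ω').2 j ⟨i₀, by omega, hi₀⟩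
      unfold closeTimesFraction
      rw [div_le_iff₀ hap]
      have h2 := Finset.card_filter_add_card_filter_not (s := Finset.range (a j))
        (fun i => dist (T^[i] (y ω)) (T^[i] (y ω')) < t₀)
      simp only [not_lt, Finset.card_range] at h2
      have h3 : ((((Finset.range (a j)).filter fun i =>
          dist (T^[i] (y ω)) (T^[i] (y ω')) < t₀).card : ℝ)) +
          (((Finset.range (a j)).filter fun i =>
            t₀ ≤ dist (T^[i] (y ω)) (T^[i] (y ω'))).card : ℝ) = a j := by exact_mod_cast h2
      linarith
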